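/- Let d be a positive even integer and y₁, …, y_{d+1} ∈ ℝ^d with y_{d+1} = 0. Fix 0 < r < R, let (Ω, 𝒜, P̄) be a probability space and L : Ω → 𝒫(ℝ^d) a map such that: (a) L(ω) is an (r,R)-Delone set for every ω; (b) for every Borel set V ⊆ ℝ^d the function ω ↦ #(L(ω) ∩ V) is measurable and ∫_Ω #(L(ω) ∩ V) dP̄(ω) equals the Lebesgue measure of V; (c) for every c ∈ ℝ^d there is a measurable P̄-preserving map ι_c : Ω → Ω with L(ι_c ω) = {2c − w : w ∈ L(ω)} for all ω. Then the function ω ↦ Σ_{w ∈ L(ω)} tr( γ₀ ∏_{i=1}^{d} γ·( (y_i − w)^ − (y_{i+1} − w)^ ) ) is P̄-integrable and ∫_Ω Σ_{w ∈ L(ω)} tr( γ₀ ∏_{i=1}^{d} γ·( (y_i − w)^ − (y_{i+1} − w)^ ) ) dP̄(ω) = Λ_d · Σ_{λ ∈ S_d} sgn(λ) ∏_{i=1}^{d} (y_i)_{λ_i}, where Λ_d = (2iπ)^{d/2} / (d/2)!. -/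

import Mathlib

open scoped Classical ENNReal
open MeasureTheory

/-- The normalization map: `v̂ = v/‖v‖` if `v ≠ 0`, and `0̂ = 0`. -/
noncomputable def unitHat {d : ℕ} (v : EuclideanSpace ℝ (Fin d)) : EuclideanSpace ℝ (Fin d) :=
  if v = 0 then 0 else ‖v‖⁻¹ • v

/-- `γ · v = Σ_j v_j γ_j`. -/
noncomputable def gammaDot {d n : ℕ} (γ : Fin d → Matrix (Fin n) (Fin n) ℂ)
    (v : EuclideanSpace ℝ (Fin d)) : Matrix (Fin n) (Fin n) ℂ :=
  ∑ j : Fin d, (v j : ℂ) • γ j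

/-- The grading `γ₀ = (−i)^{d/2} γ₁ ⋯ γ_d`. -/
noncomputable def gammaZero {d n : ℕ} (γ : Fin d → Matrix (Fin n) (Fin n) ℂ) :
    Matrix (Fin n) (Fin n) ℂ :=
  ((-Complex.I) ^ (d / 2)) • ((List.finRange d).map γ).prod

/-- The summand `w ↦ tr(γ₀ ∏_{i=1}^d γ·((y_i − w)^ − (y_{i+1} − w)^))`. -/
noncomputable def cliffordIntegrand {d n : ℕ} (γ : Fin d → Matrix (Fin n) (Fin n) ℂ)
    (y : Fin (d + 1) → EuclideanSpace ℝ (Fin d)) (w : EuclideanSpace ℝ (Fin d)) : ℂ :=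
  Matrix.trace (gammaZero γ *
    ((List.finRange d).map (fun i : Fin d =>
      gammaDot γ (unitHat (y i.castSucc - w) - unitHat (y i.succ - w)))).prod)

/-- The constant `Λ_d = (2iπ)^{d/2} / (d/2)!`. -/
noncomputable def LambdaD (d : ℕ) : ℂ :=
  (2 * Complex.I * (Real.pi : ℂ)) ^ (d / 2) / (Nat.factorial (d / 2) : ℂ)

section Clifford

lemma mul_prod_map_of_notMem {ι A : Type*} [Ring A] {g : ι → A}
    (hg : ∀ i j, i ≠ j → g i * g j = -(g j * g i)) {j : ι} (l : List ι) (hj : j ∉ l) :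
    g j * (l.map g).prod = (-1) ^ l.length * ((l.map g).prod * g j) := by
  induction l with
  | nil => simp
  | cons a l ih =>
    simp only [List.mem_cons, not_or] at hj
    have h1 := ih hj.2
    have h2 := hg j a hj.1
    have h3 : g a * (-1) ^ l.length = (-1) ^ l.length * g a :=
      ((Commute.neg_one_left (g a)).pow_left _).eq.symm
    simp only [List.map_cons, List.prod_cons, List.length_cons, pow_succ]
    rw [← mul_assoc, h2, neg_mul, mul_assoc, h1, ← mul_assoc (g a), h3]
    noncomm_ring

lemma mul_prod_map_of_mem {ι A : Type*} [Ring A] {g : ι → A}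
    (hg : ∀ i j, i ≠ j → g i * g j = -(g j * g i)) {j : ι} (l : List ι) (hl : l.Nodup)
    (hj : j ∈ l) :
    g j * (l.map g).prod = (-1) ^ (l.length + 1) * ((l.map g).prod * g j) := by
  induction l with
  | nil => simp at hj
  | cons a l ih =>
    rw [List.nodup_cons] at hl
    have h3 : g a * (-1) ^ l.length = (-1) ^ l.length * g a :=
      ((Commute.neg_one_left (g a)).pow_left _).eq.symm
    simp only [List.map_cons, List.prod_cons, List.length_cons, pow_succ]
    rcases List.mem_cons.1 hj with rfl | hj'
    · have := mul_prod_map_of_notMem hg l hl.1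
      rw [mul_neg_one, mul_neg_one, neg_neg]
      conv_lhs => rw [this, ← mul_assoc, h3]
      simp only [mul_assoc]
    · have hne : j ≠ a := fun h => hl.1 (h ▸ hj')
      have h1 := ih hl.2 hj'
      rw [← mul_assoc, hg j a hne, neg_mul, mul_assoc, h1, pow_succ, ← mul_assoc (g a),
        ← mul_assoc (g a), h3]
      noncomm_ring

lemma prod_map_mul_self {ι A : Type*} [Ring A] {g : ι → A}
    (hg : ∀ i j, i ≠ j → g i * g j = -(g j * g i)) (hsq : ∀ i, g i * g i = 1)
    (l : List ι) (hl : l.Nodup) :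
    (l.map g).prod * (l.map g).prod = (-1) ^ (l.length.choose 2) := by
  induction l with
  | nil => simp
  | cons a l ih =>
    rw [List.nodup_cons] at hl
    have h1 := mul_prod_map_of_notMem hg l hl.1
    have h2 := ih hl.2
    have h4 : ((-1 : A) ^ l.length) * (-1) ^ l.length = 1 := by
      rw [← pow_add, (Even.add_self _).neg_one_pow]
    simp only [List.map_cons, List.prod_cons, List.length_cons]
    rw [Nat.choose_succ_succ' l.length 1, Nat.choose_one_right, pow_add, ← h2]
    have h5 : (l.map g).prod * g a = (-1) ^ l.length * (g a * (l.map g).prod) := by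
      rw [h1, ← mul_assoc, h4, one_mul]
    rw [show g a * (l.map g).prod * (g a * (l.map g).prod)
      = g a * ((l.map g).prod * g a) * (l.map g).prod by noncomm_ring, h5]
    have h3 : g a * (-1) ^ l.length = (-1) ^ l.length * g a :=
      ((Commute.neg_one_left (g a)).pow_left _).eq.symm
    rw [← mul_assoc (g a), h3, mul_assoc _ (g a), ← mul_assoc (g a) (g a), hsq]
    noncomm_ring

lemma prod_map_comp_swap {A : Type*} [Ring A] {m : ℕ} {g : Fin (m + 1) → A}
    (hg : ∀ i j, i ≠ j → g i * g j = -(g j * g i)) (i : Fin m) :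
    ((List.finRange (m + 1)).map (g ∘ Equiv.swap i.castSucc i.succ)).prod
      = -((List.finRange (m + 1)).map g).prod := by
  have hsplit : List.finRange (m + 1) = (List.finRange (m + 1)).take i
      ++ i.castSucc :: i.succ :: (List.finRange (m + 1)).drop (i + 2) := by
    conv_lhs => rw [← List.take_append_drop i (List.finRange (m + 1))]
    rw [List.drop_eq_getElem_cons (by simp), List.drop_eq_getElem_cons (by simp)]
    simp [Fin.ext_iff]
  have hnd := List.nodup_finRange (m + 1)
  rw [hsplit] at hnd ⊢
  generalize (List.finRange (m + 1)).take i = l₁ at hnd ⊢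
  generalize (List.finRange (m + 1)).drop (i + 2) = l₂ at hnd ⊢
  have hne : i.castSucc ≠ i.succ := by simp [Fin.ext_iff]
  have e₁ : l₁.map (g ∘ Equiv.swap i.castSucc i.succ) = l₁.map g := by
    refine List.map_congr_left fun a ha => ?_
    simp only [Function.comp]
    rw [Equiv.swap_apply_of_ne_of_ne] <;> rintro rfl <;>
      simp [List.nodup_append] at hnd <;> grind
  have e₂ : l₂.map (g ∘ Equiv.swap i.castSucc i.succ) = l₂.map g := by
    refine List.map_congr_left fun a ha => ?_
    simp only [Function.comp]
    rw [Equiv.swap_apply_of_ne_of_ne] <;> rintro rfl <;>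
      simp [List.nodup_append] at hnd <;> grind
  simp only [List.map_append, List.map_cons, List.prod_append, List.prod_cons, e₁, e₂,
    Function.comp, Equiv.swap_apply_left, Equiv.swap_apply_right]
  rw [← mul_assoc (g i.succ), hg _ _ hne.symm]
  noncomm_ring

lemma prod_map_comp_perm {A : Type*} [Ring A] {d : ℕ} {g : Fin d → A}
    (hg : ∀ i j, i ≠ j → g i * g j = -(g j * g i)) (σ : Equiv.Perm (Fin d)) :
    ((List.finRange d).map (g ∘ σ)).prod
      = ((Equiv.Perm.sign σ : ℤ) : A) * ((List.finRange d).map g).prod := by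
  cases d with
  | zero => simp [Subsingleton.elim σ 1]
  | succ m =>
    have hσ : σ ∈ Submonoid.closure
        (Set.range fun i : Fin m => Equiv.swap i.castSucc i.succ) := by
      rw [Equiv.Perm.mclosure_swap_castSucc_succ]; trivial
    induction hσ using Submonoid.closure_induction_right with
    | one => simp
    | mul_right x hx y hy ih =>
      obtain ⟨i, rfl⟩ := hy
      have hne : i.castSucc ≠ i.succ := by simp [Fin.ext_iff]
      have := prod_map_comp_swap (g := g ∘ x)
        (fun a b hab => hg _ _ (x.injective.ne hab)) i
      rw [Equiv.Perm.coe_mul, ← Function.comp_assoc, this, ih, Equiv.Perm.sign_mul,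
        Equiv.Perm.sign_swap hne]
      simp

variable {d n : ℕ} {γ : Fin d → Matrix (Fin n) (Fin n) ℂ}

lemma anticomm_of_clifford
    (hγ : ∀ i j, γ i * γ j + γ j * γ i = (if i = j then (2 : ℂ) else 0) • 1) (i j : Fin d)
    (hij : i ≠ j) : γ i * γ j = -(γ j * γ i) := by
  have := hγ i j
  rw [if_neg hij, zero_smul] at this
  exact eq_neg_of_add_eq_zero_left this

lemma mul_self_of_clifford
    (hγ : ∀ i j, γ i * γ j + γ j * γ i = (if i = j then (2 : ℂ) else 0) • 1) (i : Fin d) :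
    γ i * γ i = 1 := by
  have := hγ i i
  rw [if_pos rfl, ← two_smul ℂ] at this
  exact smul_right_injective _ (two_ne_zero' ℂ) this

lemma trace_gammaZero_mul_eq_zero (hdeven : Even d)
    (hγ : ∀ i j, γ i * γ j + γ j * γ i = (if i = j then (2 : ℂ) else 0) • 1)
    (f : Fin d → Fin d) (hf : ¬ Function.Surjective f) :
    Matrix.trace (gammaZero γ * ((List.finRange d).map (fun i => γ (f i))).prod) = 0 := by
  simp only [Function.Surjective, not_forall, not_exists] at hf
  obtain ⟨k, hk⟩ := hf
  have hg := anticomm_of_clifford hγ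
  have h1 : γ k * gammaZero γ = -(gammaZero γ * γ k) := by
    have := mul_prod_map_of_mem hg (List.finRange d) (List.nodup_finRange d)
      (List.mem_finRange k)
    rw [List.length_finRange, hdeven.add_one.neg_one_pow] at this
    rw [gammaZero, mul_smul_comm, this, smul_mul_assoc]
    simp
  have h2 : γ k * ((List.finRange d).map (fun i => γ (f i))).prod
      = ((List.finRange d).map (fun i => γ (f i))).prod * γ k := by
    have := mul_prod_map_of_notMem (j := k) hg ((List.finRange d).map f) (by simpa using hk)
    rw [List.length_map, List.length_finRange, hdeven.neg_one_pow, one_mul, List.map_map] at this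
    exact this
  set X := ((List.finRange d).map (fun i => γ (f i))).prod
  have h3 : Matrix.trace (gammaZero γ * X) = -Matrix.trace (gammaZero γ * X) := by
    calc Matrix.trace (gammaZero γ * X)
        = Matrix.trace (gammaZero γ * X * γ k * γ k) := by
          rw [mul_assoc _ (γ k), mul_self_of_clifford hγ, mul_one]
      _ = Matrix.trace (γ k * gammaZero γ * (X * γ k)) := by
          rw [Matrix.trace_mul_comm]; noncomm_ring
      _ = -Matrix.trace (gammaZero γ * (γ k * X * γ k)) := by
          rw [h1, ← Matrix.trace_neg]; noncomm_ring
      _ = -Matrix.trace (gammaZero γ * X) := by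
          rw [h2, mul_assoc, mul_self_of_clifford hγ, mul_one]
  exact self_eq_neg.1 h3

lemma trace_gammaZero_mul_prod (hdeven : Even d) (hn : n = 2 ^ (d / 2))
    (hγ : ∀ i j, γ i * γ j + γ j * γ i = (if i = j then (2 : ℂ) else 0) • 1) :
    Matrix.trace (gammaZero γ * ((List.finRange d).map γ).prod)
      = (2 * Complex.I) ^ (d / 2) := by
  rw [gammaZero, smul_mul_assoc, prod_map_mul_self (anticomm_of_clifford hγ)
    (mul_self_of_clifford hγ) _ (List.nodup_finRange d), List.length_finRange]
  obtain ⟨k, rfl⟩ := hdeven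
  have hk : (k + k) / 2 = k := by omega
  have hc : (-1 : Matrix (Fin n) (Fin n) ℂ) ^ ((k + k).choose 2) = (-1 : ℂ) ^ k • 1 := by
    have h1 : (k + k).choose 2 = k * (k + k - 1) := by
      rw [Nat.choose_two_right, ← two_mul, mul_assoc, Nat.mul_div_cancel_left _ two_pos]
    rw [h1, mul_comm, pow_mul]
    rcases Nat.eq_zero_or_pos k with rfl | hpos
    · simp
    · have : Odd (k + k - 1) := ⟨k - 1, by omega⟩
      rw [this.neg_one_pow]
      rcases Nat.even_or_odd k with h | h <;> simp [h.neg_one_pow]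
  rw [hc, hk, Matrix.trace_smul, Matrix.trace_smul, Matrix.trace_one, Fintype.card_fin, hn, hk]
  push_cast
  rw [smul_eq_mul, smul_eq_mul, ← mul_pow, ← mul_pow]
  congr 1
  ring

/-- The determinant of the matrix whose rows are the given vectors. -/
noncomputable def rowDet {d : ℕ} (v : Fin d → EuclideanSpace ℝ (Fin d)) : ℝ :=
  Matrix.det (Matrix.of fun i j => v i j)

lemma ofReal_rowDet {d : ℕ} (v : Fin d → EuclideanSpace ℝ (Fin d)) :
    (rowDet v : ℂ) = ∑ σ : Equiv.Perm (Fin d),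
      ((Equiv.Perm.sign σ : ℤ) : ℂ) * ∏ i, ((v i (σ i) : ℝ) : ℂ) := by
  rw [rowDet, ← Matrix.det_transpose, Matrix.det_apply']
  push_cast
  simp [Matrix.transpose_apply]

lemma trace_gammaZero_mul_gammaDot (hdeven : Even d) (hn : n = 2 ^ (d / 2))
    (hγ : ∀ i j, γ i * γ j + γ j * γ i = (if i = j then (2 : ℂ) else 0) • 1)
    (v : Fin d → EuclideanSpace ℝ (Fin d)) :
    Matrix.trace (gammaZero γ * ((List.finRange d).map (fun i => gammaDot γ (v i))).prod)
      = (2 * Complex.I) ^ (d / 2) * (rowDet v : ℂ) := by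
  have hexp : ((List.finRange d).map (fun i => gammaDot γ (v i))).prod
      = ∑ f : Fin d → Fin d, (∏ i, (v i (f i) : ℂ)) •
        ((List.finRange d).map (fun i => γ (f i))).prod := by
    have h := (MultilinearMap.mkPiAlgebraFin ℂ d (Matrix (Fin n) (Fin n) ℂ)).map_sum
      (fun i j => (v i j : ℂ) • γ j)
    simp only [MultilinearMap.map_smul_univ, MultilinearMap.mkPiAlgebraFin_apply,
      List.ofFn_eq_map] at h
    exact h
  rw [hexp, Finset.mul_sum, Matrix.trace_sum]
  simp only [mul_smul_comm, Matrix.trace_smul, smul_eq_mul]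
  have hperm : ∀ σ : Equiv.Perm (Fin d),
      Matrix.trace (gammaZero γ * ((List.finRange d).map (fun i => γ (σ i))).prod)
        = ((Equiv.Perm.sign σ : ℤ) : ℂ) * (2 * Complex.I) ^ (d / 2) := by
    intro σ
    have := prod_map_comp_perm (anticomm_of_clifford hγ) σ
    simp only [Function.comp_def] at this
    rw [this, ← trace_gammaZero_mul_prod hdeven hn hγ]
    rcases Int.units_eq_one_or (Equiv.Perm.sign σ) with h | h <;> simp [h]
  rw [ofReal_rowDet, Finset.mul_sum]
  symm
  refine Finset.sum_of_injOn (fun σ : Equiv.Perm (Fin d) => (σ : Fin d → Fin d))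
    (fun a _ b _ h => DFunLike.coe_injective h)
    (fun _ _ => Finset.mem_coe.2 (Finset.mem_univ _)) ?_ ?_
  · intro f _ hf
    rw [trace_gammaZero_mul_eq_zero hdeven hγ f, mul_zero]
    intro hs
    exact hf ⟨Equiv.ofBijective f (Finite.surjective_iff_bijective.1 hs), by simp, rfl⟩
  · intro σ _
    rw [hperm σ]
    ring

end Clifford

section Cofactors

variable {d : ℕ}

/-- The linear map sending `t` to the linear combination `∑ i, t i • v i`. -/
noncomputable def combMap (v : Fin d → EuclideanSpace ℝ (Fin d)) :
    EuclideanSpace ℝ (Fin d) →ₗ[ℝ] EuclideanSpace ℝ (Fin d) :=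
  Matrix.toLpLin 2 2 (Matrix.of fun i j => v i j).transpose

lemma combMap_apply (v : Fin d → EuclideanSpace ℝ (Fin d)) (t : EuclideanSpace ℝ (Fin d)) :
    combMap v t = ∑ i, t i • v i := by
  ext k
  simp [combMap, Matrix.toLpLin_apply, Matrix.mulVec, dotProduct, mul_comm]

lemma det_combMap (v : Fin d → EuclideanSpace ℝ (Fin d)) :
    LinearMap.det (combMap v) = rowDet v := by
  rw [combMap, LinearMap.det_toLpLin, Matrix.det_transpose, rowDet]

lemma combMap_bijective {v : Fin d → EuclideanSpace ℝ (Fin d)} (hv : rowDet v ≠ 0) :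
    Function.Bijective (combMap v) := by
  rw [← det_combMap] at hv
  exact (LinearMap.equivOfDetNeZero _ hv).bijective

lemma rowDet_smul (a : Fin d → ℝ) (v : Fin d → EuclideanSpace ℝ (Fin d)) :
    rowDet (fun i => a i • v i) = (∏ i, a i) * rowDet v := by
  simp only [rowDet, PiLp.smul_apply, smul_eq_mul]
  exact Matrix.det_mul_column _ _

lemma rowDet_map (f : EuclideanSpace ℝ (Fin d) →ₗ[ℝ] EuclideanSpace ℝ (Fin d))
    (v : Fin d → EuclideanSpace ℝ (Fin d)) :
    rowDet (fun i => f (v i)) = LinearMap.det f * rowDet v := by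
  rw [← det_combMap, ← det_combMap, ← LinearMap.det_comp]
  congr 1
  ext1 t
  simp [combMap_apply]

/-- The signed maximal minors of a `(d + 1)`-tuple of vectors in dimension `d`. -/
noncomputable def cofactor (V : Fin (d + 1) → EuclideanSpace ℝ (Fin d)) (j : Fin (d + 1)) : ℝ :=
  (-1) ^ (j : ℕ) * rowDet (fun i => V (j.succAbove i))

lemma sum_cofactor_mul (V : Fin (d + 1) → EuclideanSpace ℝ (Fin d)) (k : Fin d) :
    ∑ j, cofactor V j * V j k = 0 := by
  have h : (Matrix.of fun (i : Fin (d + 1)) (l : Fin (d + 1)) =>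
      (Fin.cons (V i k) (fun m => V i m) : Fin (d + 1) → ℝ) l).det = 0 :=
    Matrix.det_zero_of_column_eq (i := 0) (j := k.succ) (Fin.succ_ne_zero k).symm (by simp)
  rw [Matrix.det_succ_column_zero] at h
  rw [← h]
  refine Finset.sum_congr rfl fun j _ => ?_
  simp only [cofactor, rowDet, Matrix.of_apply, Fin.cons_zero]
  rw [mul_assoc, mul_assoc, mul_comm (V j k)]
  congr 3

lemma sum_cofactor_smul (V : Fin (d + 1) → EuclideanSpace ℝ (Fin d)) :
    ∑ j, cofactor V j • V j = 0 := by
  ext k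
  simpa using sum_cofactor_mul V k

lemma sum_cofactor (hd : Even d) (V : Fin (d + 1) → EuclideanSpace ℝ (Fin d)) :
    ∑ j, cofactor V j = rowDet (fun i => V i.castSucc - V i.succ) := by
  set A : Matrix (Fin (d + 1)) (Fin (d + 1)) ℝ :=
    Matrix.of fun i l => (Fin.cons 1 (fun m => V i m) : Fin (d + 1) → ℝ) l with hA
  set B : Matrix (Fin (d + 1)) (Fin (d + 1)) ℝ := Matrix.of fun i l =>
    (Fin.cons (Fin.cons 1 (fun m => V 0 m) : Fin (d + 1) → ℝ)
      (fun i => (Fin.cons 0 (fun m => V i.succ m - V i.castSucc m) : Fin (d + 1) → ℝ)) :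
      Fin (d + 1) → Fin (d + 1) → ℝ) i l with hB
  have hAB : A.det = B.det := by
    refine Matrix.det_eq_of_forall_row_eq_smul_add_pred (fun _ => 1) (fun j => ?_)
      (fun i j => ?_)
    · simp [hA, hB]
    · refine Fin.cases ?_ (fun m => ?_) j <;> simp [hA, hB]
  have h1 : A.det = ∑ j, cofactor V j := by
    rw [Matrix.det_succ_column_zero]
    refine Finset.sum_congr rfl fun j _ => ?_
    simp only [cofactor, rowDet, hA, Matrix.of_apply, Fin.cons_zero, mul_one]
    congr 2
  have h2 : B.det = rowDet (fun i => V i.succ - V i.castSucc) := by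
    rw [Matrix.det_succ_column_zero, Fin.sum_univ_succ]
    simp only [hB, Matrix.of_apply, Fin.cons_zero, Fin.cons_succ, mul_zero, zero_mul,
      Finset.sum_const_zero, add_zero, Fin.val_zero, pow_zero, one_mul, rowDet]
    congr 1
  have h3 := rowDet_smul (fun _ => (-1 : ℝ)) (fun i => V i.castSucc - V i.succ)
  simp only [neg_smul, one_smul, neg_sub, Finset.prod_const, Finset.card_univ, Fintype.card_fin,
    hd.neg_one_pow, one_mul] at h3
  rw [← h1, hAB, h2, h3]

lemma sum_cofactor_sub_const (hd : Even d) (V : Fin (d + 1) → EuclideanSpace ℝ (Fin d))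
    (w : EuclideanSpace ℝ (Fin d)) :
    ∑ j, cofactor (fun i => V i - w) j = ∑ j, cofactor V j := by
  simp [sum_cofactor hd]

lemma sum_cofactor_of_last_eq_zero (hd : Even d) {V : Fin (d + 1) → EuclideanSpace ℝ (Fin d)}
    (hV : V (Fin.last d) = 0) : ∑ j, cofactor V j = rowDet (fun i => V i.castSucc) := by
  rw [Finset.sum_eq_single (Fin.last d)]
  · simp [cofactor, hd.neg_one_pow]
  · intro j _ hj
    obtain ⟨i, hi⟩ := Fin.exists_succAbove_eq hj.symm
    rw [cofactor, rowDet, Matrix.det_eq_zero_of_row_eq_zero i, mul_zero]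
    intro k
    simp [hi, hV]
  · simp

lemma exists_eq_mul_cofactor {V : Fin (d + 1) → EuclideanSpace ℝ (Fin d)} {k : Fin (d + 1)}
    (hk : cofactor V k ≠ 0) {b : Fin (d + 1) → ℝ} (hb : ∑ i, b i • V i = 0) :
    ∃ s : ℝ, ∀ i, b i = s * cofactor V i := by
  set s := b k / cofactor V k with hs
  have hdet : rowDet (fun i => V (k.succAbove i)) ≠ 0 := right_ne_zero_of_mul hk
  have h0 : ∑ i, (b i - s * cofactor V i) • V i = 0 := by
    simp only [sub_smul, Finset.sum_sub_distrib, hb, mul_smul, ← Finset.smul_sum,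
      sum_cofactor_smul, smul_zero, sub_zero]
  have hbk : b k - s * cofactor V k = 0 := by rw [hs, div_mul_cancel₀ _ hk, sub_self]
  rw [Fin.sum_univ_succAbove _ k, hbk, zero_smul, zero_add] at h0
  have h1 : combMap (fun i => V (k.succAbove i))
      (WithLp.toLp 2 fun i => b (k.succAbove i) - s * cofactor V (k.succAbove i)) = 0 := by
    rw [combMap_apply]
    exact h0
  have h2 := (combMap_bijective hdet).1 (h1.trans (map_zero _).symm)
  refine ⟨s, fun i => ?_⟩
  rcases Fin.eq_self_or_eq_succAbove k i with rfl | ⟨j, rfl⟩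
  · exact sub_eq_zero.1 hbk
  · have := congrArg (fun x : EuclideanSpace ℝ (Fin d) => x j) h2
    exact sub_eq_zero.1 (by simpa using this)

lemma cofactor_smul (a : Fin (d + 1) → ℝ) (V : Fin (d + 1) → EuclideanSpace ℝ (Fin d))
    (j : Fin (d + 1)) :
    cofactor (fun i => a i • V i) j = (∏ i, a (j.succAbove i)) * cofactor V j := by
  simp only [cofactor]
  rw [rowDet_smul (fun i => a (j.succAbove i)) (fun i => V (j.succAbove i))]
  ring

end Cofactors

section EndpointCount

variable {ι : Type*} [Fintype ι]

lemma sum_pos_endpoint {l c : ι → ℝ}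
    (hgen : ∀ s i j, i ≠ j → c i + s * l i = 0 → c j + s * l j ≠ 0) (hl : ∃ j, 0 < l j) :
    ∑ j, (if 0 < l j ∧ ∃ s, c j + s * l j = 0 ∧ ∀ i, i ≠ j → 0 < c i + s * l i
      then (1 : ℝ) else 0) = if ∃ s, ∀ i, 0 ≤ c i + s * l i then 1 else 0 := by
  obtain ⟨j₀, hj₀⟩ := hl
  obtain ⟨k, hk, hmax⟩ := Finset.exists_max_image (Finset.univ.filter fun j => 0 < l j)
    (fun j => -c j / l j) ⟨j₀, by simpa using hj₀⟩
  simp only [Finset.mem_filter, Finset.mem_univ, true_and] at hk hmax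
  have key : ∀ j, (0 < l j ∧ ∃ s, c j + s * l j = 0 ∧ ∀ i, i ≠ j → 0 < c i + s * l i) ↔
      (j = k ∧ ∃ s, ∀ i, 0 ≤ c i + s * l i) := by
    intro j
    constructor
    · rintro ⟨hj, s, hs, hpos⟩
      refine ⟨?_, s, fun i => ?_⟩
      · by_contra hne
        have h1 := hpos k (Ne.symm hne)
        have h2 := hmax j hj
        have h3 : s = -c j / l j := by field_simp; linarith
        rw [← h3, le_div_iff₀ hk] at h2
        linarith
      · rcases eq_or_ne i j with rfl | hne
        · exact hs.ge
        · exact (hpos i hne).le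
    · rintro ⟨rfl, s₀, hs₀⟩
      have hz : c j + -c j / l j * l j = 0 := by field_simp; ring
      refine ⟨hk, -c j / l j, hz, fun i hi => ?_⟩
      refine lt_of_le_of_ne ?_ (hgen _ j i hi.symm hz).symm
      rcases lt_or_ge 0 (l i) with hli | hli
      · have := hmax i hli
        rw [div_le_iff₀ hli] at this
        linarith
      · have h1 : -c j / l j ≤ s₀ := by
          rw [div_le_iff₀ hk]
          linarith [hs₀ j]
        nlinarith [hs₀ i]
  simp only [key]
  by_cases hI : ∃ s, ∀ i, 0 ≤ c i + s * l i
  · simp [hI]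
  · simp [hI]

/-- `1` if all entries are positive, `-1` if all entries are negative, and `0` otherwise. -/
noncomputable def commonSign (l : ι → ℝ) : ℝ :=
  if ∀ j, 0 < l j then 1 else if ∀ j, l j < 0 then -1 else 0

/-- The line `s ↦ c + s • l` meets the boundary of the positive orthant with signed
multiplicity `commonSign l`. -/
lemma sum_sign_endpoint [Nonempty ι] {l c : ι → ℝ}
    (hgen : ∀ s i j, i ≠ j → c i + s * l i = 0 → c j + s * l j ≠ 0)
    (hl : (∀ j, 0 < l j) ∨ (∀ j, l j < 0) ∨ ((∃ j, 0 < l j) ↔ ∃ j, l j < 0)) :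
    ∑ j, Real.sign (l j) * (if ∃ s, c j + s * l j = 0 ∧ ∀ i, i ≠ j → 0 < c i + s * l i
      then (1 : ℝ) else 0) = commonSign l := by
  set p : ι → Prop := fun j => ∃ s, c j + s * l j = 0 ∧ ∀ i, i ≠ j → 0 < c i + s * l i with hp
  have hsplit : ∀ j, Real.sign (l j) * (if p j then (1 : ℝ) else 0)
      = (if 0 < l j ∧ p j then 1 else 0) - (if 0 < -l j ∧ p j then 1 else 0) := by
    intro j
    rcases lt_trichotomy (l j) 0 with h | h | h
    · simp [Real.sign_of_neg h, h, h.not_gt]; split_ifs <;> simp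
    · simp [h]
    · simp [Real.sign_of_pos h, h, h.not_gt]
  have hflip : ∀ q : ℝ → Prop, (∃ s, q s) ↔ ∃ s, q (-s) :=
    fun q => ⟨fun ⟨s, h⟩ => ⟨-s, by simpa using h⟩, fun ⟨s, h⟩ => ⟨_, h⟩⟩
  have hpos := sum_pos_endpoint hgen
  have hneg : (∃ j, 0 < -l j) → ∑ j, (if 0 < -l j ∧ p j then (1 : ℝ) else 0)
      = if ∃ s, ∀ i, 0 ≤ c i + s * l i then 1 else 0 := by
    intro h
    have := sum_pos_endpoint (l := fun j => -l j) (c := c)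
      (fun s i j hij => by simpa using hgen (-s) i j hij) h
    rw [hflip fun s => ∀ i, 0 ≤ c i + s * l i]
    simp only [hp]
    simp only [mul_neg, ← neg_mul] at this ⊢
    rw [← this]
    refine Finset.sum_congr rfl fun j _ => ?_
    rw [hflip fun s => c j + s * l j = 0 ∧ ∀ i, i ≠ j → 0 < c i + s * l i]
  have hI : ((∀ j, 0 < l j) ∨ ∀ j, l j < 0) → ∃ s, ∀ i, 0 ≤ c i + s * l i := by
    rintro (h | h)
    · refine ⟨∑ i, |c i| / l i, fun i => ?_⟩
      have h1 := Finset.single_le_sum (f := fun i => |c i| / l i)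
        (fun k _ => div_nonneg (abs_nonneg _) (h k).le) (Finset.mem_univ i)
      rw [div_le_iff₀ (h i)] at h1
      linarith [neg_abs_le (c i)]
    · refine ⟨∑ i, |c i| / l i, fun i => ?_⟩
      have h1 := Finset.sum_le_sum_of_subset_of_nonneg (f := fun i => -(|c i| / l i))
        (Finset.subset_univ {i}) (fun k _ _ => by
          rw [← div_neg]; exact div_nonneg (abs_nonneg _) (by linarith [h k]))
      rw [Finset.sum_singleton, Finset.sum_neg_distrib, neg_le_neg_iff,
        le_div_iff_of_neg (h i)] at h1
      linarith [neg_abs_le (c i)]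
  refine (Finset.sum_congr rfl fun j _ => hsplit j).trans ?_
  rw [Finset.sum_sub_distrib]
  obtain ⟨i₀⟩ := ‹Nonempty ι›
  rcases hl with h | h | h
  · rw [hpos ⟨i₀, h i₀⟩, if_pos (hI (.inl h)), commonSign, if_pos h,
      Finset.sum_eq_zero fun j _ => by simp [(h j).le], sub_zero]
  · have h' : ¬ ∀ j, 0 < l j := fun h' => (h i₀).not_gt (h' i₀)
    rw [hneg ⟨i₀, by linarith [h i₀]⟩, if_pos (hI (.inr h)), commonSign, if_neg h', if_pos h,
      Finset.sum_eq_zero fun j _ => by simp [(h j).not_gt], zero_sub]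
  · have hc : commonSign l = 0 := by
      rw [commonSign, if_neg, if_neg]
      · intro hn
        obtain ⟨j, hj⟩ := h.2 ⟨i₀, hn i₀⟩
        exact (hn j).not_gt hj
      · intro hn
        obtain ⟨j, hj⟩ := h.1 ⟨i₀, hn i₀⟩
        exact (hn j).not_gt hj
    rw [hc]
    by_cases hP : ∃ j, 0 < l j
    · rw [hpos hP, hneg (by simpa using h.1 hP), sub_self]
    · have hN : ¬ ∃ j, l j < 0 := fun hN => hP (h.2 hN)
      push Not at hP hN
      rw [Finset.sum_eq_zero fun j _ => by simp [(hP j).not_gt],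
        Finset.sum_eq_zero fun j _ => by simp [(hN j).not_gt], sub_zero]

end EndpointCount

section Sectors

variable {d : ℕ}

/-- The positive combinations of `v` of norm less than one, in the coordinates given
by `v`. -/
def sectorCoords (v : Fin d → EuclideanSpace ℝ (Fin d)) : Set (EuclideanSpace ℝ (Fin d)) :=
  {t | (∀ i, 0 < t i) ∧ ‖combMap v t‖ < 1}

/-- The open simplicial cone generated by all vectors of `V` except `V j`. -/
def faceCone (V : Fin (d + 1) → EuclideanSpace ℝ (Fin d)) (j : Fin (d + 1)) :
    Set (EuclideanSpace ℝ (Fin d)) :=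
  {u | ∃ a : Fin (d + 1) → ℝ, ∑ i, a i • V i = u ∧ a j = 0 ∧ ∀ i, i ≠ j → 0 < a i}

lemma isOpen_forall_pos : IsOpen {t : EuclideanSpace ℝ (Fin d) | ∀ i, 0 < t i} := by
  rw [Set.ofPred_forall]
  exact isOpen_iInter_of_finite fun i => isOpen_lt continuous_const (by fun_prop)

lemma faceCone_eq_image (V : Fin (d + 1) → EuclideanSpace ℝ (Fin d)) (j : Fin (d + 1)) :
    faceCone V j = combMap (fun i => V (j.succAbove i)) '' {t | ∀ i, 0 < t i} := by
  ext u
  constructor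
  · rintro ⟨a, rfl, haj, ha⟩
    refine ⟨WithLp.toLp 2 fun i => a (j.succAbove i), fun i => ha _ (Fin.succAbove_ne j i), ?_⟩
    rw [combMap_apply, Fin.sum_univ_succAbove _ j, haj, zero_smul, zero_add]
  · rintro ⟨t, ht, rfl⟩
    refine ⟨j.insertNth 0 t, ?_, by simp, fun i hi => ?_⟩
    · rw [combMap_apply, Fin.sum_univ_succAbove _ j]
      simp
    · obtain ⟨k, rfl⟩ := Fin.exists_succAbove_eq hi
      simpa using ht k

lemma image_sectorCoords (v : Fin d → EuclideanSpace ℝ (Fin d)) :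
    combMap v '' sectorCoords v = combMap v '' {t | ∀ i, 0 < t i} ∩ Metric.ball 0 1 := by
  ext u
  constructor
  · rintro ⟨t, ⟨ht, hn⟩, rfl⟩
    exact ⟨⟨t, ht, rfl⟩, by simpa using hn⟩
  · rintro ⟨⟨t, ht, rfl⟩, hn⟩
    exact ⟨t, ⟨ht, by simpa using hn⟩, rfl⟩

lemma abs_rowDet_mul_volume_sectorCoords (v : Fin d → EuclideanSpace ℝ (Fin d)) :
    |rowDet v| * volume.real (sectorCoords v) = volume.real (combMap v '' sectorCoords v) := by
  rw [Measure.real, Measure.real, Measure.addHaar_image_linearMap, det_combMap,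
    ENNReal.toReal_mul, ENNReal.toReal_ofReal (abs_nonneg _)]

lemma abs_rowDet_mul_volume_sectorCoords_le (v : Fin d → EuclideanSpace ℝ (Fin d)) :
    |rowDet v| * volume.real (sectorCoords v)
      ≤ volume.real (Metric.ball (0 : EuclideanSpace ℝ (Fin d)) 1) := by
  rw [abs_rowDet_mul_volume_sectorCoords, image_sectorCoords]
  exact measureReal_mono Set.inter_subset_right measure_ball_lt_top.ne

lemma ae_forall_at_most_one_eq_zero (V : Fin (d + 1) → EuclideanSpace ℝ (Fin d)) :
    ∀ᵐ u : EuclideanSpace ℝ (Fin d), ∀ a : Fin (d + 1) → ℝ, ∑ i, a i • V i = u →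
      ∀ i j, i ≠ j → a i = 0 → a j ≠ 0 := by
  have h : ∀ i j : Fin (d + 1), i ≠ j → ∀ᵐ u : EuclideanSpace ℝ (Fin d),
      u ∉ (Submodule.span ℝ ((({i, j}ᶜ : Finset (Fin (d + 1))).image V : Finset _) : Set
        (EuclideanSpace ℝ (Fin d))) : Set (EuclideanSpace ℝ (Fin d))) := by
    intro i j hij
    refine measure_eq_zero_iff_ae_notMem.1 (Measure.addHaar_submodule _ _ fun htop => ?_)
    have h1 := finrank_span_finset_le_card (R := ℝ) (({i, j}ᶜ : Finset (Fin (d + 1))).image V)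
    rw [Set.finrank, htop, finrank_top, finrank_euclideanSpace_fin] at h1
    have h2 := h1.trans Finset.card_image_le
    rw [Finset.card_compl, Finset.card_pair hij, Fintype.card_fin] at h2
    have := i.isLt
    have := j.isLt
    have : (i : ℕ) ≠ j := fun h => hij (Fin.ext h)
    omega
  have h' : ∀ᵐ u : EuclideanSpace ℝ (Fin d), ∀ i j : Fin (d + 1), i ≠ j →
      u ∉ (Submodule.span ℝ ((({i, j}ᶜ : Finset (Fin (d + 1))).image V : Finset _) : Set
        (EuclideanSpace ℝ (Fin d))) : Set (EuclideanSpace ℝ (Fin d))) := by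
    simpa only [ae_all_iff] using h
  filter_upwards [h'] with u hu a ha i j hij hi hj
  refine hu i j hij ?_
  rw [← ha, ← Finset.sum_subset (Finset.subset_univ ({i, j}ᶜ : Finset (Fin (d + 1))))]
  · refine Submodule.sum_mem _ fun k hk => Submodule.smul_mem _ _ (Submodule.subset_span ?_)
    exact Finset.mem_coe.2 (Finset.mem_image_of_mem V hk)
  · intro k _ hk
    simp only [Finset.mem_compl, not_not, Finset.mem_insert, Finset.mem_singleton] at hk
    rcases hk with rfl | rfl <;> simp [hi, hj]

/-- The signed volumes of the spherical sectors over the faces of a simplex add up to the signed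
volume of the ball if the origin lies inside the simplex and to `0` otherwise. -/
lemma sum_cofactor_mul_volume_sectorCoords (V : Fin (d + 1) → EuclideanSpace ℝ (Fin d))
    (hV : (∀ j, 0 < cofactor V j) ∨ (∀ j, cofactor V j < 0) ∨
      ((∃ j, 0 < cofactor V j) ↔ ∃ j, cofactor V j < 0)) :
    ∑ j, cofactor V j * volume.real (sectorCoords fun i => V (j.succAbove i))
      = commonSign (cofactor V)
        * volume.real (Metric.ball (0 : EuclideanSpace ℝ (Fin d)) 1) := by
  by_cases h0 : ∀ j, cofactor V j = 0
  · simp [h0, commonSign]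
  push Not at h0
  obtain ⟨k, hk⟩ := h0
  have habs : ∀ j, |cofactor V j| = |rowDet fun i => V (j.succAbove i)| := fun j => by
    simp [cofactor, abs_mul]
  have hopen : ∀ j, cofactor V j ≠ 0 → MeasurableSet (faceCone V j) := by
    intro j hj
    rw [faceCone_eq_image]
    exact ((LinearEquiv.ofBijective _ (combMap_bijective
      (right_ne_zero_of_mul hj))).toContinuousLinearEquiv.toHomeomorph.isOpenMap _
      isOpen_forall_pos).measurableSet
  have hterm : ∀ j, cofactor V j * volume.real (sectorCoords fun i => V (j.succAbove i))
      = ∫ u in Metric.ball (0 : EuclideanSpace ℝ (Fin d)) 1,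
        Real.sign (cofactor V j) * (faceCone V j).indicator (fun _ => (1 : ℝ)) u := by
    intro j
    by_cases hj : cofactor V j = 0
    · simp [hj]
    rw [integral_const_mul, integral_indicator_const _ (hopen j hj), smul_eq_mul, mul_one,
      measureReal_restrict_apply (hopen j hj), faceCone_eq_image, ← image_sectorCoords,
      ← abs_rowDet_mul_volume_sectorCoords, ← habs, ← mul_assoc]
    congr 1
    rcases lt_or_gt_of_ne hj with h | h
    · rw [Real.sign_of_neg h, abs_of_neg h]; ring
    · rw [Real.sign_of_pos h, abs_of_pos h]; ring
  have hint : ∀ j, IntegrableOn (fun u => Real.sign (cofactor V j)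
      * (faceCone V j).indicator (fun _ => (1 : ℝ)) u)
      (Metric.ball (0 : EuclideanSpace ℝ (Fin d)) 1) := by
    intro j
    by_cases hj : cofactor V j = 0
    · simp [hj, IntegrableOn]
    · refine Integrable.const_mul (Integrable.indicator ?_ (hopen j hj)) _
      exact integrableOn_const measure_ball_lt_top.ne
  rw [Finset.sum_congr rfl fun j _ => hterm j, ← integral_finsetSum _ fun j _ => hint j]
  have hae : ∀ᵐ u ∂(volume.restrict (Metric.ball (0 : EuclideanSpace ℝ (Fin d)) 1)),
      ∑ j, Real.sign (cofactor V j) * (faceCone V j).indicator (fun _ => (1 : ℝ)) u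
        = commonSign (cofactor V) := by
    filter_upwards [ae_restrict_of_ae (ae_forall_at_most_one_eq_zero V)] with u hu
    obtain ⟨t, ht⟩ := (combMap_bijective (right_ne_zero_of_mul hk)).2 u
    obtain ⟨c, hc⟩ : ∃ c : Fin (d + 1) → ℝ, ∑ i, c i • V i = u := by
      refine ⟨k.insertNth 0 t, ?_⟩
      rw [← ht, combMap_apply, Fin.sum_univ_succAbove _ k]
      simp
    have hline : ∀ s : ℝ, ∑ i, (c i + s * cofactor V i) • V i = u := by
      intro s
      simp only [add_smul, Finset.sum_add_distrib, hc, mul_smul, ← Finset.smul_sum,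
        sum_cofactor_smul, smul_zero, add_zero]
    rw [← sum_sign_endpoint (c := c) (fun s i j hij => hu _ (hline s) i j hij) hV]
    refine Finset.sum_congr rfl fun j _ => ?_
    rw [Set.indicator_apply]
    congr 1
    refine if_congr ?_ rfl rfl
    constructor
    · rintro ⟨a, ha, haj, hpos⟩
      obtain ⟨s, hs⟩ := exists_eq_mul_cofactor hk (b := fun i => a i - c i)
        (by simp only [sub_smul, Finset.sum_sub_distrib, ha, hc, sub_self])
      have hs' : ∀ i, c i + s * cofactor V i = a i := fun i => by rw [← hs i]; ring
      exact ⟨s, by rw [hs', haj], fun i hi => by rw [hs']; exact hpos i hi⟩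
    · rintro ⟨s, hs, hpos⟩
      exact ⟨_, hline s, hs, hpos⟩
  rw [integral_congr_ae hae, integral_const, smul_eq_mul, mul_comm]
  simp

end Sectors

section FaceDefect

variable {d : ℕ}

lemma norm_unitHat_of_ne_zero {v : EuclideanSpace ℝ (Fin d)} (hv : v ≠ 0) :
    ‖unitHat v‖ = 1 := by
  rw [unitHat, if_neg hv, norm_smul, norm_inv, norm_norm, inv_mul_cancel₀ (norm_ne_zero_iff.2 hv)]

lemma norm_unitHat_le_one (v : EuclideanSpace ℝ (Fin d)) : ‖unitHat v‖ ≤ 1 := by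
  by_cases hv : v = 0
  · simp [unitHat, hv]
  · exact (norm_unitHat_of_ne_zero hv).le

lemma unitHat_map (f : EuclideanSpace ℝ (Fin d) ≃ₗᵢ[ℝ] EuclideanSpace ℝ (Fin d))
    (v : EuclideanSpace ℝ (Fin d)) : unitHat (f v) = f (unitHat v) := by
  by_cases hv : v = 0
  · simp [unitHat, hv]
  · simp [unitHat, hv]

lemma measurable_unitHat : Measurable (unitHat (d := d)) :=
  Measurable.ite (measurableSet_singleton 0) measurable_const
    (measurable_norm.inv.smul measurable_id)

lemma norm_unitHat_sub_unitHat_le {a : EuclideanSpace ℝ (Fin d)} (ha : a ≠ 0)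
    (b : EuclideanSpace ℝ (Fin d)) : ‖unitHat a - unitHat b‖ ≤ 2 * ‖a - b‖ / ‖a‖ := by
  have hpos : 0 < ‖a‖ := norm_pos_iff.2 ha
  rw [le_div_iff₀ hpos]
  by_cases hb : b = 0
  · have : unitHat (0 : EuclideanSpace ℝ (Fin d)) = 0 := by simp [unitHat]
    rw [hb, this, sub_zero, sub_zero, norm_unitHat_of_ne_zero ha]
    linarith
  have hbpos : 0 < ‖b‖ := norm_pos_iff.2 hb
  have h1 : ‖a‖ • (unitHat a - unitHat b) = (a - b) + (‖b‖ - ‖a‖) • unitHat b := by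
    rw [unitHat, unitHat, if_neg ha, if_neg hb, smul_sub, sub_smul, smul_smul, smul_smul,
      smul_smul, mul_inv_cancel₀ hpos.ne', mul_inv_cancel₀ hbpos.ne', one_smul, one_smul]
    abel
  calc ‖unitHat a - unitHat b‖ * ‖a‖ = ‖‖a‖ • (unitHat a - unitHat b)‖ := by
        rw [norm_smul, norm_norm, mul_comm]
    _ ≤ ‖a - b‖ + |‖b‖ - ‖a‖| * 1 := by
        rw [h1]
        refine (norm_add_le _ _).trans ?_
        rw [norm_smul, norm_unitHat_of_ne_zero hb, Real.norm_eq_abs]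
    _ ≤ 2 * ‖a - b‖ := by
        have := abs_norm_sub_norm_le b a
        rw [norm_sub_rev b a] at this
        linarith

lemma continuous_rowDet : Continuous (rowDet (d := d)) := by
  unfold rowDet
  refine Continuous.matrix_det (continuous_matrix fun i j => ?_)
  simp only [Matrix.of_apply]
  fun_prop

lemma abs_rowDet_le (v : Fin d → EuclideanSpace ℝ (Fin d)) :
    |rowDet v| ≤ d.factorial * ∏ i, ‖v i‖ := by
  rw [rowDet, ← Matrix.det_transpose, Matrix.det_apply]
  refine (Finset.abs_sum_le_sum_abs _ _).trans ?_
  have : ∀ σ ∈ (Finset.univ : Finset (Equiv.Perm (Fin d))),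
      |Equiv.Perm.sign σ • ∏ i, (Matrix.of fun i j => v i j).transpose (σ i) i|
        ≤ ∏ i, ‖v i‖ := by
    intro σ _
    have h : |Equiv.Perm.sign σ • ∏ i, (Matrix.of fun i j => v i j).transpose (σ i) i|
        = ∏ i, |v i (σ i)| := by
      rcases Int.units_eq_one_or (Equiv.Perm.sign σ) with h | h <;>
        simp [h, Finset.abs_prod]
    rw [h]
    exact Finset.prod_le_prod (fun _ _ => abs_nonneg _) fun i _ =>
      by simpa using PiLp.norm_apply_le (v i) (σ i)
  refine (Finset.sum_le_card_nsmul _ _ _ this).trans ?_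
  simp [Fintype.card_perm]

lemma abs_rowDet_le_of_norm_sub_le {v : Fin d → EuclideanSpace ℝ (Fin d)} {i₀ : Fin d} {δ : ℝ}
    (h₀ : ‖v i₀‖ ≤ 1) (hδ : ∀ i, ‖v i - v i₀‖ ≤ δ) :
    |rowDet v| ≤ d.factorial * δ ^ (d - 1) := by
  have hsub : rowDet v = rowDet (fun i => if i = i₀ then v i₀ else v i - v i₀) := by
    refine Matrix.det_eq_of_forall_row_eq_smul_add_const (fun i => if i = i₀ then 0 else 1) i₀
      (by simp) fun i j => ?_
    by_cases hi : i = i₀ <;> simp [hi]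
  rw [hsub]
  refine (abs_rowDet_le _).trans (mul_le_mul_of_nonneg_left ?_ (Nat.cast_nonneg _))
  rw [← Finset.mul_prod_erase _ _ (Finset.mem_univ i₀), if_pos rfl]
  have h1 : ∏ i ∈ Finset.univ.erase i₀, ‖if i = i₀ then v i₀ else v i - v i₀‖
      ≤ ∏ _i ∈ Finset.univ.erase i₀, δ := by
    refine Finset.prod_le_prod (fun _ _ => norm_nonneg _) fun i hi => ?_
    rw [if_neg (Finset.ne_of_mem_erase hi)]
    exact hδ i
  rw [Finset.prod_const, Finset.card_erase_of_mem (Finset.mem_univ _), Finset.card_univ,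
    Fintype.card_fin] at h1
  calc _ ≤ 1 * _ := mul_le_mul_of_nonneg_right h₀ (Finset.prod_nonneg fun _ _ => norm_nonneg _)
    _ ≤ _ := by rw [one_mul]; exact h1

/-- The open simplex spanned by the origin and the standard basis. -/
def cornerSimplex (d : ℕ) : Set (EuclideanSpace ℝ (Fin d)) :=
  {t | (∀ i, 0 < t i) ∧ ∑ i, t i < 1}

lemma isOpen_cornerSimplex : IsOpen (cornerSimplex d) :=
  isOpen_forall_pos.inter (isOpen_lt
    (show Continuous fun t : EuclideanSpace ℝ (Fin d) => ∑ i, t i by fun_prop) continuous_const)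

lemma cornerSimplex_subset_sectorCoords {v : Fin d → EuclideanSpace ℝ (Fin d)}
    (hv : ∀ i, ‖v i‖ ≤ 1) : cornerSimplex d ⊆ sectorCoords v := by
  rintro t ⟨ht, hs⟩
  refine ⟨ht, lt_of_le_of_lt ?_ hs⟩
  rw [combMap_apply]
  refine (norm_sum_le _ _).trans (Finset.sum_le_sum fun i _ => ?_)
  rw [norm_smul, Real.norm_of_nonneg (ht i).le]
  exact mul_le_of_le_one_right (ht i).le (hv i)

lemma volume_sectorCoords_lt_top {v : Fin d → EuclideanSpace ℝ (Fin d)} (hv : rowDet v ≠ 0) :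
    volume (sectorCoords v) < ∞ := by
  have h : ENNReal.ofReal |rowDet v| * volume (sectorCoords v) < ∞ := by
    rw [← det_combMap, ← Measure.addHaar_image_linearMap, image_sectorCoords]
    exact (measure_mono Set.inter_subset_right).trans_lt measure_ball_lt_top
  have h0 : ENNReal.ofReal |rowDet v| ≠ 0 := by simpa using hv
  exact ENNReal.lt_top_of_mul_ne_top_right h.ne h0

lemma volume_cornerSimplex_lt_top : volume (cornerSimplex d) < ∞ := by
  have hdet : rowDet (fun i : Fin d => EuclideanSpace.single i (1 : ℝ)) = 1 := by
    rw [rowDet, ← Matrix.det_one (n := Fin d) (R := ℝ)]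
    congr 1
    ext i j
    simp [Matrix.one_apply, eq_comm]
  refine (measure_mono (cornerSimplex_subset_sectorCoords fun i => ?_)).trans_lt
    (volume_sectorCoords_lt_top (hdet.trans_ne one_ne_zero))
  simp

lemma volume_cornerSimplex_pos : 0 < volume.real (cornerSimplex d) := by
  refine ENNReal.toReal_pos (isOpen_cornerSimplex.measure_pos _ ?_).ne'
    volume_cornerSimplex_lt_top.ne
  refine ⟨WithLp.toLp 2 fun _ => 1 / (d + 1 : ℝ), fun i => by simp; positivity, ?_⟩
  simp only [Finset.sum_const, Finset.card_univ, Fintype.card_fin, nsmul_eq_mul]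
  rw [mul_one_div, div_lt_one (by positivity)]
  linarith

open scoped Pointwise in
lemma sectorCoords_subset_smul_cornerSimplex {v : Fin d → EuclideanSpace ℝ (Fin d)} {i₀ : Fin d}
    {δ : ℝ} (hv : ∀ i, ‖v i‖ = 1) (hδ : ∀ i, ‖v i - v i₀‖ ≤ δ) (hδ1 : δ ≤ 1) :
    sectorCoords v ⊆ (1 + δ ^ 2) • cornerSimplex d := by
  rintro t ⟨ht, hn⟩
  have hδ0 : 0 ≤ δ := (norm_nonneg _).trans (hδ i₀)
  have hpos : 0 < 1 + δ ^ 2 := by positivity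
  have hinner : ∀ i, 1 - δ ^ 2 / 2 ≤ inner ℝ (v i) (v i₀) := by
    intro i
    have h1 := norm_sub_sq_real (v i) (v i₀)
    rw [hv, hv] at h1
    have h2 := pow_le_pow_left₀ (norm_nonneg _) (hδ i) 2
    linarith
  have hsum : (∑ i, t i) * (1 - δ ^ 2 / 2) < 1 := by
    calc (∑ i, t i) * (1 - δ ^ 2 / 2) = ∑ i, t i * (1 - δ ^ 2 / 2) := Finset.sum_mul _ _ _
      _ ≤ ∑ i, t i * inner ℝ (v i) (v i₀) :=
          Finset.sum_le_sum fun i _ => mul_le_mul_of_nonneg_left (hinner i) (ht i).le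
      _ = inner ℝ (combMap v t) (v i₀) := by
          rw [combMap_apply, sum_inner]
          exact Finset.sum_congr rfl fun i _ => (real_inner_smul_left _ _ _).symm
      _ ≤ ‖combMap v t‖ * ‖v i₀‖ := real_inner_le_norm _ _
      _ < 1 := by rwa [hv, mul_one]
  rw [Set.mem_smul_set_iff_inv_smul_mem₀ hpos.ne']
  refine ⟨fun i => mul_pos (inv_pos.2 hpos) (ht i), ?_⟩
  simp only [PiLp.smul_apply, smul_eq_mul, ← Finset.mul_sum]
  rw [inv_mul_lt_iff₀ hpos, mul_one]
  have hS : 0 ≤ ∑ i, t i := Finset.sum_nonneg fun i _ => (ht i).le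
  have hx1 : δ ^ 2 ≤ 1 := pow_le_one₀ hδ0 hδ1
  have hx0 : 0 ≤ δ ^ 2 := sq_nonneg δ
  generalize δ ^ 2 = x at *
  have hx : 1 ≤ (1 + x) * (1 - x / 2) := by nlinarith
  have : 0 < 1 - x / 2 := by linarith
  nlinarith

lemma one_add_pow_le {x : ℝ} (h0 : 0 ≤ x) (h1 : x ≤ 1) (m : ℕ) :
    (1 + x) ^ m ≤ 1 + 2 ^ m * x := by
  suffices h : (1 + x) ^ m ≤ 1 + (2 ^ m - 1) * x by linarith
  induction m with
  | zero => simp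
  | succ m ih =>
    have h2 : (1 : ℝ) ≤ 2 ^ m := one_le_pow₀ one_le_two
    calc (1 + x) ^ (m + 1) = (1 + x) ^ m * (1 + x) := pow_succ _ _
      _ ≤ (1 + (2 ^ m - 1) * x) * (1 + x) := mul_le_mul_of_nonneg_right ih (by linarith)
      _ ≤ 1 + (2 ^ (m + 1) - 1) * x := by
        rw [pow_succ]
        nlinarith [mul_nonneg (mul_nonneg (sub_nonneg.2 h2) h0) (sub_nonneg.2 h1)]

open scoped Pointwise in
lemma abs_volume_cornerSimplex_sub_le {v : Fin d → EuclideanSpace ℝ (Fin d)} {i₀ : Fin d} {δ : ℝ}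
    (hv : ∀ i, ‖v i‖ = 1) (hδ : ∀ i, ‖v i - v i₀‖ ≤ δ) (hδ1 : δ ≤ 1) :
    |volume.real (cornerSimplex d) - volume.real (sectorCoords v)|
      ≤ 2 ^ d * δ ^ 2 * volume.real (cornerSimplex d) := by
  have hδ0 : 0 ≤ δ := (norm_nonneg _).trans (hδ i₀)
  have hsub := sectorCoords_subset_smul_cornerSimplex hv hδ hδ1
  have hvol : volume ((1 + δ ^ 2) • cornerSimplex d)
      = ENNReal.ofReal ((1 + δ ^ 2) ^ d) * volume (cornerSimplex d) := by
    rw [Measure.addHaar_smul, finrank_euclideanSpace_fin, abs_of_nonneg (by positivity)]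
  have hfin : volume ((1 + δ ^ 2) • cornerSimplex d) ≠ ∞ := by
    rw [hvol]
    exact ENNReal.mul_ne_top ENNReal.ofReal_ne_top volume_cornerSimplex_lt_top.ne
  have h1 : volume.real (sectorCoords v) ≤ (1 + δ ^ 2) ^ d * volume.real (cornerSimplex d) := by
    refine (measureReal_mono hsub hfin).trans_eq ?_
    rw [Measure.real, hvol, ENNReal.toReal_mul, ENNReal.toReal_ofReal (by positivity),
      Measure.real]
  have h2 : volume.real (cornerSimplex d) ≤ volume.real (sectorCoords v) :=
    measureReal_mono (cornerSimplex_subset_sectorCoords fun i => (hv i).le)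
      (measure_ne_top_of_subset hsub hfin)
  have h3 := one_add_pow_le (sq_nonneg δ) (pow_le_one₀ hδ0 hδ1) d
  have h4 := mul_le_mul_of_nonneg_right h3 (volume_cornerSimplex_pos (d := d)).le
  rw [abs_sub_comm, abs_of_nonneg (sub_nonneg.2 h2)]
  linarith

/-- The difference, up to normalization, between the signed volumes of the simplex spanned by
the origin and `v` and of the spherical sector spanned by `v`. -/
noncomputable def sectorDefect (v : Fin d → EuclideanSpace ℝ (Fin d)) : ℝ :=
  rowDet v * (volume.real (cornerSimplex d) - volume.real (sectorCoords v))

lemma measurable_sectorDefect : Measurable (sectorDefect (d := d)) := by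
  refine (continuous_rowDet.measurable).mul (measurable_const.sub ?_)
  have hs : MeasurableSet {p : (Fin d → EuclideanSpace ℝ (Fin d)) × EuclideanSpace ℝ (Fin d) |
      p.2 ∈ sectorCoords p.1} := by
    refine IsOpen.measurableSet (IsOpen.inter (isOpen_forall_pos.preimage continuous_snd) ?_)
    refine isOpen_lt (Continuous.norm ?_) continuous_const
    simp only [combMap_apply]
    fun_prop
  exact (measurable_measure_prodMk_left hs).ennreal_toReal

lemma sectorDefect_map {f : EuclideanSpace ℝ (Fin d) ≃ₗᵢ[ℝ] EuclideanSpace ℝ (Fin d)}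
    (v : Fin d → EuclideanSpace ℝ (Fin d)) :
    sectorDefect (fun i => f (v i))
      = LinearMap.det (f.toLinearEquiv : EuclideanSpace ℝ (Fin d) →ₗ[ℝ] _) * sectorDefect v := by
  have h1 : sectorCoords (fun i => f (v i)) = sectorCoords v := by
    ext t
    have : combMap (fun i => f (v i)) t = f (combMap v t) := by simp [combMap_apply]
    simp [sectorCoords, this]
  have h2 := rowDet_map (f.toLinearEquiv : EuclideanSpace ℝ (Fin d) →ₗ[ℝ] _) v
  rw [sectorDefect, sectorDefect, h1, ← mul_assoc, ← h2]
  rfl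

lemma abs_sectorDefect_le {v : Fin d → EuclideanSpace ℝ (Fin d)} (hv : ∀ i, ‖v i‖ ≤ 1) :
    |sectorDefect v| ≤ d.factorial * volume.real (cornerSimplex d)
      + volume.real (Metric.ball (0 : EuclideanSpace ℝ (Fin d)) 1) := by
  have h1 : |rowDet v| ≤ d.factorial := by
    refine (abs_rowDet_le v).trans (mul_le_of_le_one_right (Nat.cast_nonneg _) ?_)
    exact Finset.prod_le_one (fun _ _ => norm_nonneg _) fun i _ => hv i
  rw [sectorDefect, mul_sub]
  refine (abs_sub _ _).trans (add_le_add ?_ ?_)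
  · rw [abs_mul, abs_of_nonneg measureReal_nonneg]
    exact mul_le_mul_of_nonneg_right h1 measureReal_nonneg
  · rw [abs_mul, abs_of_nonneg (measureReal_nonneg (μ := volume) (s := sectorCoords v))]
    exact abs_rowDet_mul_volume_sectorCoords_le v

lemma abs_sectorDefect_le_of_norm_sub_le {v : Fin d → EuclideanSpace ℝ (Fin d)} {i₀ : Fin d}
    {δ : ℝ} (hv : ∀ i, ‖v i‖ = 1) (hδ : ∀ i, ‖v i - v i₀‖ ≤ δ) (hδ1 : δ ≤ 1) :
    |sectorDefect v|
      ≤ d.factorial * 2 ^ d * volume.real (cornerSimplex d) * δ ^ (d + 1) := by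
  have hd : d + 1 = (d - 1) + 2 := by have := i₀.isLt; omega
  have hδ0 : 0 ≤ δ := (norm_nonneg _).trans (hδ i₀)
  rw [sectorDefect, abs_mul]
  refine (mul_le_mul (abs_rowDet_le_of_norm_sub_le (hv i₀).le hδ)
    (abs_volume_cornerSimplex_sub_le hv hδ hδ1) (abs_nonneg _) (by positivity)).trans_eq ?_
  rw [hd, pow_add]
  ring

lemma norm_unitHat_sub_unitHat_le_div {a b w : EuclideanSpace ℝ (Fin d)} {A : ℝ}
    (ha : ‖a‖ ≤ A / 8) (hb : ‖b‖ ≤ A / 8) (hA : 0 < A) (hw : A ≤ ‖w‖) :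
    ‖unitHat (a - w) - unitHat (b - w)‖ ≤ A / ‖w‖ := by
  have hfar : ‖w‖ / 2 ≤ ‖a - w‖ := by
    have h1 := norm_sub_norm_le w a
    rw [norm_sub_rev] at h1
    linarith
  have hne : a - w ≠ 0 := norm_pos_iff.1 (by linarith)
  refine (norm_unitHat_sub_unitHat_le hne _).trans ?_
  rw [div_le_div_iff₀ (norm_pos_iff.2 hne) (by linarith)]
  have h1 : ‖a - w - (b - w)‖ ≤ A / 4 := by
    rw [sub_sub_sub_cancel_right]
    linarith [norm_sub_le a b]
  have h2 := mul_le_mul_of_nonneg_right h1 (norm_nonneg w)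
  have h3 := mul_le_mul_of_nonneg_left hfar hA.le
  linarith

lemma abs_sectorDefect_unitHat_le {q : Fin d → EuclideanSpace ℝ (Fin d)} (hd : 0 < d)
    {A C₀ C₁ : ℝ} (hA : 1 ≤ A) (hq : ∀ i, ‖q i‖ ≤ A / 8) (hC₀ : 0 ≤ C₀) (hC₁ : 0 ≤ C₁)
    (hnear : ∀ v : Fin d → EuclideanSpace ℝ (Fin d), (∀ i, ‖v i‖ ≤ 1) → |sectorDefect v| ≤ C₁)
    (hfar : ∀ (v : Fin d → EuclideanSpace ℝ (Fin d)) (i₀ : Fin d) (δ : ℝ), (∀ i, ‖v i‖ = 1) →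
      (∀ i, ‖v i - v i₀‖ ≤ δ) → δ ≤ 1 → |sectorDefect v| ≤ C₀ * δ ^ (d + 1))
    (w : EuclideanSpace ℝ (Fin d)) :
    |sectorDefect fun i => unitHat (q i - w)|
      ≤ (C₀ * (2 * A) ^ (d + 1) + C₁ * (1 + A) ^ (d + 1)) * ((1 + ‖w‖) ^ (d + 1))⁻¹ := by
  have hA0 : 0 < A := by linarith
  have hw1 : 0 < (1 + ‖w‖) ^ (d + 1) := by positivity
  rw [← div_eq_mul_inv, le_div_iff₀ hw1]
  rcases lt_or_ge ‖w‖ A with hw | hw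
  · have h1 := hnear (fun i => unitHat (q i - w)) fun i => norm_unitHat_le_one _
    have h2 : (1 + ‖w‖) ^ (d + 1) ≤ (1 + A) ^ (d + 1) :=
      pow_le_pow_left₀ (by positivity) (by linarith) _
    have h3 : 0 ≤ C₀ * (2 * A) ^ (d + 1) := by positivity
    have h4 := mul_le_mul h1 h2 hw1.le hC₁
    linarith
  · have hwpos : 0 < ‖w‖ := by linarith
    have hne : ∀ i, q i - w ≠ 0 := fun i h => by
      have := hq i
      rw [sub_eq_zero.1 h] at this
      linarith
    have h1 := hfar (fun i => unitHat (q i - w)) ⟨0, hd⟩ (A / ‖w‖)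
      (fun i => norm_unitHat_of_ne_zero (hne i))
      (fun i => norm_unitHat_sub_unitHat_le_div (hq i) (hq _) hA0 hw) ((div_le_one hwpos).2 hw)
    have h2 : A / ‖w‖ * (1 + ‖w‖) ≤ 2 * A := by
      rw [div_mul_eq_mul_div, div_le_iff₀ hwpos]
      nlinarith
    have h3 : 0 ≤ C₁ * (1 + A) ^ (d + 1) := by positivity
    have h4 : (A / ‖w‖ * (1 + ‖w‖)) ^ (d + 1) ≤ (2 * A) ^ (d + 1) :=
      pow_le_pow_left₀ (by positivity) h2 _
    have h5 := mul_le_mul_of_nonneg_right h1 hw1.le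
    rw [mul_assoc, ← mul_pow] at h5
    have h6 := mul_le_mul_of_nonneg_left h4 hC₀
    linarith

lemma integrable_sectorDefect (hd : 0 < d) (q : Fin d → EuclideanSpace ℝ (Fin d)) :
    Integrable fun w => sectorDefect fun i => unitHat (q i - w) := by
  have hbase : Integrable fun w : EuclideanSpace ℝ (Fin d) => ((1 + ‖w‖) ^ (d + 1))⁻¹ := by
    have := integrable_one_add_norm (E := EuclideanSpace ℝ (Fin d)) (μ := volume)
      (r := ((d + 1 : ℕ) : ℝ)) (by rw [finrank_euclideanSpace_fin]; push_cast; linarith)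
    refine this.congr (ae_of_all _ fun w => ?_)
    simp only
    rw [Real.rpow_neg (by positivity), Real.rpow_natCast]
  have hq : ∀ i, ‖q i‖ ≤ 8 * (1 + ∑ i, ‖q i‖) / 8 := fun i => by
    have := Finset.single_le_sum (f := fun i => ‖q i‖) (fun _ _ => norm_nonneg _)
      (Finset.mem_univ i)
    linarith
  refine (hbase.const_mul _).mono' ?_ (ae_of_all _ fun w => abs_sectorDefect_unitHat_le hd
    (by linarith [Finset.sum_nonneg fun i (_ : i ∈ Finset.univ) => norm_nonneg (q i)]) hq
    (by positivity) (by positivity) (fun _ => abs_sectorDefect_le)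
    (fun _ _ _ => abs_sectorDefect_le_of_norm_sub_le) w)
  refine (measurable_sectorDefect.comp (measurable_pi_lambda _ fun i => ?_)).aestronglyMeasurable
  exact measurable_unitHat.comp (measurable_const.sub measurable_id)

lemma integral_sectorDefect (hd : 0 < d) (q : Fin d → EuclideanSpace ℝ (Fin d)) :
    ∫ w, sectorDefect (fun i => unitHat (q i - w)) = 0 := by
  have i₀ : Fin d := ⟨0, hd⟩
  obtain ⟨ν, hν0, hν⟩ : ∃ ν : Fin d → ℝ, ν ≠ 0 ∧
      (Matrix.of fun i j => (q i - q i₀) j).mulVec ν = 0 := by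
    refine Matrix.exists_mulVec_eq_zero_iff.2 (Matrix.det_eq_zero_of_row_eq_zero i₀ ?_)
    simp
  set u : EuclideanSpace ℝ (Fin d) := WithLp.toLp 2 ν with hu
  have hu0 : u ≠ 0 := fun h => hν0 (by simpa [hu] using h)
  set ρ := (Submodule.span ℝ {u})ᗮ.reflection with hρ
  have hfix : ∀ i, ρ (q i - q i₀) = q i - q i₀ := by
    intro i
    refine Submodule.reflection_mem_subspace_eq_self ?_
    rw [Submodule.mem_orthogonal_singleton_iff_inner_right]
    have := congrFun hν i
    simpa [Matrix.mulVec, dotProduct, PiLp.inner_apply, hu, mul_comm] using this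
  have hdet : LinearMap.det (ρ.toLinearEquiv : EuclideanSpace ℝ (Fin d) →ₗ[ℝ] _) = -1 := by
    have := Submodule.det_reflection (Submodule.span ℝ {u})ᗮ
    rw [Submodule.orthogonal_orthogonal, finrank_span_singleton hu0, pow_one] at this
    exact this
  set g : EuclideanSpace ℝ (Fin d) → ℝ :=
    fun w => sectorDefect fun i => unitHat (q i - (q i₀ + w)) with hg
  have hodd : ∀ w, g (ρ w) = -g w := by
    intro w
    have : ∀ i, unitHat (q i - (q i₀ + ρ w)) = ρ (unitHat (q i - (q i₀ + w))) := fun i => by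
      rw [← unitHat_map, ← sub_sub, ← sub_sub, map_sub ρ (q i - q i₀), hfix]
    simp only [hg, this]
    rw [sectorDefect_map, hdet, neg_one_mul]
  have h1 : ∫ w, g w = ∫ w, sectorDefect (fun i => unitHat (q i - w)) :=
    integral_add_left_eq_self (fun w => sectorDefect fun i => unitHat (q i - w)) (q i₀)
  have h2 : ∫ w, g (ρ w) = ∫ w, g w :=
    ρ.measurePreserving.integral_comp ρ.toHomeomorph.measurableEmbedding g
  simp only [hodd, integral_neg] at h2
  rw [← h1]
  linarith

end FaceDefect

section CommonSign

variable {ι : Type*}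

lemma mul_neg_iff_of_pos_left {a b : ℝ} (ha : 0 < a) : a * b < 0 ↔ b < 0 :=
  smul_neg_iff_of_pos_left ha

lemma commonSign_mul_of_pos [Fintype ι] {a : ι → ℝ} (ha : ∀ i, 0 < a i) (l : ι → ℝ) :
    commonSign (fun i => a i * l i) = commonSign l := by
  simp only [commonSign, mul_pos_iff_of_pos_left (ha _), mul_neg_iff_of_pos_left (ha _)]

lemma commonSign_of_sum_eq_zero [Fintype ι] [Nonempty ι] {l : ι → ℝ} (hl : ∑ i, l i = 0) :
    commonSign l = 0 := by
  rw [commonSign, if_neg, if_neg]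
  · exact fun h => (Finset.sum_neg (fun i _ => h i) Finset.univ_nonempty).ne hl
  · exact fun h => (Finset.sum_pos (fun i _ => h i) Finset.univ_nonempty).ne' hl

lemma commonSign_const_mul [Fintype ι] [Nonempty ι] {D : ℝ} (hD : D ≠ 0) {b : ι → ℝ}
    (hb : ∑ i, b i = 1) :
    commonSign (fun i => D * b i) = Real.sign D * if ∀ i, 0 < b i then 1 else 0 := by
  have hneg : ¬ ∀ i, b i < 0 := fun h => by
    linarith [Finset.sum_neg (fun i _ => h i) (Finset.univ_nonempty (α := ι))]
  rcases lt_or_gt_of_ne hD with h | h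
  · have hpos : ∀ i, 0 < D * b i ↔ b i < 0 := fun i => smul_pos_iff_of_neg_left h
    have hneg' : ∀ i, D * b i < 0 ↔ 0 < b i := fun i => smul_neg_iff_of_neg_left h
    simp only [commonSign, hpos, hneg', hneg,
      Real.sign_of_neg h, if_false]
    split_ifs <;> simp
  · simp only [commonSign, mul_pos_iff_of_pos_left h, mul_neg_iff_of_pos_left h, hneg,
      Real.sign_of_pos h, if_false, one_mul]

lemma exists_pos_iff_exists_neg_of_sum_eq_zero [Fintype ι] {l : ι → ℝ} (hl : ∑ i, l i = 0) :
    (∃ i, 0 < l i) ↔ ∃ i, l i < 0 := by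
  constructor
  · rintro ⟨i, hi⟩
    by_contra! h
    exact (Finset.sum_pos' (fun i _ => h i) ⟨i, Finset.mem_univ _, hi⟩).ne' hl
  · rintro ⟨i, hi⟩
    by_contra! h
    exact (Finset.sum_neg' (fun i _ => h i) ⟨i, Finset.mem_univ _, hi⟩).ne hl

lemma forall_pos_or_forall_neg_or_of_ne_zero {l : ι → ℝ} (hl : ∀ i, l i ≠ 0) :
    (∀ i, 0 < l i) ∨ (∀ i, l i < 0) ∨ ((∃ i, 0 < l i) ↔ ∃ i, l i < 0) := by
  by_cases h1 : ∃ i, 0 < l i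
  · by_cases h2 : ∃ i, l i < 0
    · exact .inr (.inr (iff_of_true h1 h2))
    · push Not at h2
      exact .inl fun i => (h2 i).lt_of_ne' (hl i)
  · push Not at h1
    exact .inr (.inl fun i => (h1 i).lt_of_ne (hl i))

end CommonSign

section Translates

variable {d : ℕ}

lemma cofactor_sub_combMap (hd : Even d) {y : Fin (d + 1) → EuclideanSpace ℝ (Fin d)}
    (hy : y (Fin.last d) = 0) (hD : rowDet (fun i => y i.castSucc) ≠ 0)
    (t : EuclideanSpace ℝ (Fin d)) :
    cofactor (fun i => y i - combMap (fun i => y i.castSucc) t)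
      = fun j => rowDet (fun i => y i.castSucc)
        * (Fin.snoc (fun i => t i) (1 - ∑ i, t i) : Fin (d + 1) → ℝ) j := by
  set D := rowDet (fun i => y i.castSucc) with hDdef
  set w := combMap (fun i => y i.castSucc) t with hw
  set b : Fin (d + 1) → ℝ := Fin.snoc (fun i => t i) (1 - ∑ i, t i) with hb
  have hsum : ∑ j, cofactor (fun i => y i - w) j = D := by
    rw [sum_cofactor_sub_const hd, sum_cofactor_of_last_eq_zero hd hy]
  obtain ⟨k, -, hk⟩ := Finset.exists_ne_zero_of_sum_ne_zero (hsum.trans_ne hD)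
  have hb1 : ∑ i, b i = 1 := by
    rw [Fin.sum_univ_castSucc]
    simp [hb]
  have hb0 : ∑ i, b i • (y i - w) = 0 := by
    simp only [smul_sub, Finset.sum_sub_distrib, ← Finset.sum_smul, hb1, one_smul]
    rw [Fin.sum_univ_castSucc, hy, smul_zero, add_zero, hw, combMap_apply]
    simp [hb]
  obtain ⟨s, hs⟩ := exists_eq_mul_cofactor hk hb0
  have hsD : s * D = 1 := by
    rw [← hsum, Finset.mul_sum, ← hb1]
    exact Finset.sum_congr rfl fun i _ => (hs i).symm
  funext j
  rw [hs j, ← mul_assoc, mul_comm D s, hsD, one_mul]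

lemma ae_of_ae_combMap {v : Fin d → EuclideanSpace ℝ (Fin d)} (hv : rowDet v ≠ 0)
    {p : EuclideanSpace ℝ (Fin d) → Prop} (h : ∀ᵐ t, p (combMap v t)) : ∀ᵐ w, p w := by
  rw [ae_iff] at h ⊢
  have himage : {w | ¬ p w} = combMap v '' {t | ¬ p (combMap v t)} := by
    ext w
    obtain ⟨t, rfl⟩ := (combMap_bijective hv).2 w
    simp only [Set.mem_ofPred_eq, (combMap_bijective hv).1.mem_set_image]
  rw [himage, Measure.addHaar_image_linearMap, h, mul_zero]

lemma ae_linearMap_ne {ℓ : EuclideanSpace ℝ (Fin d) →ₗ[ℝ] ℝ} (hℓ : ℓ ≠ 0) (b : ℝ) :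
    ∀ᵐ t, ℓ t ≠ b := by
  obtain ⟨t₀, ht₀⟩ := LinearMap.surjective hℓ b
  have h := measure_eq_zero_iff_ae_notMem.1 (Measure.addHaar_submodule volume (LinearMap.ker ℓ)
    fun h => hℓ (LinearMap.ker_eq_top.1 h))
  have h' := (measurePreserving_add_left volume (-t₀)).quasiMeasurePreserving.ae h
  filter_upwards [h'] with t ht hb
  refine ht ?_
  simp [ht₀, hb]

lemma ae_cofactor_sub_ne_zero (hd : 0 < d) (hdeven : Even d)
    {y : Fin (d + 1) → EuclideanSpace ℝ (Fin d)} (hy : y (Fin.last d) = 0)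
    (hD : rowDet (fun i => y i.castSucc) ≠ 0) :
    ∀ᵐ w, ∀ j, cofactor (fun i => y i - w) j ≠ 0 := by
  refine ae_of_ae_combMap hD ?_
  have h1 : ∀ i : Fin d, ∀ᵐ t : EuclideanSpace ℝ (Fin d), t i ≠ 0 := fun i =>
    ae_linearMap_ne (ℓ := (EuclideanSpace.proj i : EuclideanSpace ℝ (Fin d) →L[ℝ] ℝ).toLinearMap)
      (fun h => by simpa using DFunLike.congr_fun h (EuclideanSpace.single i (1 : ℝ))) 0
  have h2 : ∀ᵐ t : EuclideanSpace ℝ (Fin d), ∑ i, t i ≠ 1 := by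
    have := ae_linearMap_ne (d := d) (ℓ := ∑ i, (EuclideanSpace.proj i :
      EuclideanSpace ℝ (Fin d) →L[ℝ] ℝ).toLinearMap)
      (fun h => by simpa using DFunLike.congr_fun h (EuclideanSpace.single ⟨0, hd⟩ (1 : ℝ))) 1
    simpa using this
  filter_upwards [ae_all_iff.2 h1, h2] with t ht1 ht2 j
  rw [cofactor_sub_combMap hdeven hy hD]
  refine mul_ne_zero hD ?_
  refine Fin.lastCases ?_ (fun i => ?_) j
  · simpa using sub_ne_zero.2 ht2.symm
  · simpa using ht1 i

lemma commonSign_cofactor_sub (hdeven : Even d)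
    {y : Fin (d + 1) → EuclideanSpace ℝ (Fin d)} (hy : y (Fin.last d) = 0)
    (hD : rowDet (fun i => y i.castSucc) ≠ 0) (w : EuclideanSpace ℝ (Fin d)) :
    commonSign (cofactor fun i => y i - w) = Real.sign (rowDet fun i => y i.castSucc)
      * (combMap (fun i => y i.castSucc) '' cornerSimplex d).indicator (fun _ => (1 : ℝ)) w := by
  obtain ⟨t, rfl⟩ := (combMap_bijective hD).2 w
  rw [cofactor_sub_combMap hdeven hy hD, commonSign_const_mul hD, Set.indicator_apply,
    (combMap_bijective hD).1.mem_set_image]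
  · have hiff : (∀ j, 0 < (Fin.snoc (fun i => t i) (1 - ∑ i, t i) : Fin (d + 1) → ℝ) j)
        ↔ t ∈ cornerSimplex d := by
      rw [Fin.forall_fin_succ']
      simp [cornerSimplex]
    simp only [hiff]
  · rw [Fin.sum_univ_castSucc]
    simp

lemma integrable_commonSign_cofactor_and_integral_eq (hdeven : Even d)
    {y : Fin (d + 1) → EuclideanSpace ℝ (Fin d)} (hy : y (Fin.last d) = 0) :
    Integrable (fun w => commonSign (cofactor fun i => y i - w)) ∧
      ∫ w, commonSign (cofactor fun i => y i - w)
        = rowDet (fun i => y i.castSucc) * volume.real (cornerSimplex d) := by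
  by_cases hD : rowDet (fun i => y i.castSucc) = 0
  · have : ∀ w, commonSign (cofactor fun i => y i - w) = 0 := fun w =>
      commonSign_of_sum_eq_zero (by
        rw [sum_cofactor_sub_const hdeven, sum_cofactor_of_last_eq_zero hdeven hy, hD])
    simp [this, hD]
  have hms : MeasurableSet (combMap (fun i => y i.castSucc) '' cornerSimplex d) :=
    ((LinearEquiv.ofBijective _ (combMap_bijective hD)).toContinuousLinearEquiv.toHomeomorph.isOpenMap
      _ isOpen_cornerSimplex).measurableSet
  have hvol : volume (combMap (fun i => y i.castSucc) '' cornerSimplex d)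
      = ENNReal.ofReal |rowDet fun i => y i.castSucc| * volume (cornerSimplex d) := by
    rw [Measure.addHaar_image_linearMap, det_combMap]
  have hfin : volume (combMap (fun i => y i.castSucc) '' cornerSimplex d) ≠ ∞ := by
    rw [hvol]
    exact ENNReal.mul_ne_top ENNReal.ofReal_ne_top volume_cornerSimplex_lt_top.ne
  simp only [commonSign_cofactor_sub hdeven hy hD]
  refine ⟨((integrableOn_const hfin).integrable_indicator hms).const_mul _, ?_⟩
  rw [integral_const_mul, integral_indicator_const _ hms, smul_eq_mul, mul_one, Measure.real, hvol,
    ENNReal.toReal_mul, ENNReal.toReal_ofReal (abs_nonneg _), ← mul_assoc]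
  congr 1
  rcases lt_or_gt_of_ne hD with h | h
  · rw [Real.sign_of_neg h, abs_of_neg h]; ring
  · rw [Real.sign_of_pos h, abs_of_pos h]; ring

lemma exists_pos_cofactor_unitHat {p : Fin (d + 1) → EuclideanSpace ℝ (Fin d)}
    (hp : ∀ i, p i ≠ 0) : ∃ a : Fin (d + 1) → ℝ, (∀ j, 0 < a j) ∧
      cofactor (fun i => unitHat (p i)) = fun j => a j * cofactor p j := by
  refine ⟨fun j => ∏ i, ‖p (j.succAbove i)‖⁻¹, fun j => Finset.prod_pos fun i _ =>
    inv_pos.2 (norm_pos_iff.2 (hp _)), ?_⟩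
  funext j
  rw [← cofactor_smul (fun i => ‖p i‖⁻¹)]
  simp [unitHat, hp]

/-- The alternating sum of the sector volumes over the faces of the simplex seen from `w`. -/
lemma ae_sum_cofactor_unitHat_mul_volume_sectorCoords (hd : 0 < d) (hdeven : Even d)
    {y : Fin (d + 1) → EuclideanSpace ℝ (Fin d)} (hy : y (Fin.last d) = 0) :
    ∀ᵐ w, ∑ j, cofactor (fun i => unitHat (y i - w)) j
        * volume.real (sectorCoords fun i => unitHat (y (j.succAbove i) - w))
      = commonSign (cofactor fun i => y i - w)
        * volume.real (Metric.ball (0 : EuclideanSpace ℝ (Fin d)) 1) := by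
  have : Nonempty (Fin d) := ⟨⟨0, hd⟩⟩
  have hne : ∀ᵐ w, ∀ i, y i - w ≠ 0 := by
    refine ae_all_iff.2 fun i => ?_
    filter_upwards [measure_eq_zero_iff_ae_notMem.1 (measure_singleton (μ := volume) (y i))]
      with w hw h
    exact hw (sub_eq_zero.1 h).symm
  have hsigns : ∀ᵐ w, (∀ j, 0 < cofactor (fun i => y i - w) j) ∨
      (∀ j, cofactor (fun i => y i - w) j < 0) ∨
      ((∃ j, 0 < cofactor (fun i => y i - w) j) ↔ ∃ j, cofactor (fun i => y i - w) j < 0) := by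
    by_cases hD : rowDet (fun i => y i.castSucc) = 0
    · refine ae_of_all _ fun w => .inr (.inr (exists_pos_iff_exists_neg_of_sum_eq_zero ?_))
      rw [sum_cofactor_sub_const hdeven, sum_cofactor_of_last_eq_zero hdeven hy, hD]
    · filter_upwards [ae_cofactor_sub_ne_zero hd hdeven hy hD] with w hw
      exact forall_pos_or_forall_neg_or_of_ne_zero hw
  filter_upwards [hne, hsigns] with w hw hs
  obtain ⟨a, ha, hcof⟩ := exists_pos_cofactor_unitHat hw
  have h := sum_cofactor_mul_volume_sectorCoords (fun i => unitHat (y i - w)) (by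
    simpa only [hcof, mul_pos_iff_of_pos_left (ha _), mul_neg_iff_of_pos_left (ha _)] using hs)
  rw [h, hcof, commonSign_mul_of_pos ha]

/-- The integral over all translations of the signed volume spanned by the differences of the
unit vectors pointing towards the vertices. -/
theorem integrable_rowDet_unitHat_and_integral_eq (hd : 0 < d) (hdeven : Even d)
    {y : Fin (d + 1) → EuclideanSpace ℝ (Fin d)} (hy : y (Fin.last d) = 0) :
    Integrable (fun w => rowDet fun i : Fin d =>
        unitHat (y i.castSucc - w) - unitHat (y i.succ - w)) ∧
      ∫ w, rowDet (fun i : Fin d => unitHat (y i.castSucc - w) - unitHat (y i.succ - w))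
        = volume.real (Metric.ball (0 : EuclideanSpace ℝ (Fin d)) 1)
          * rowDet (fun i => y i.castSucc) := by
  obtain ⟨hint, hval⟩ := integrable_commonSign_cofactor_and_integral_eq hdeven hy
  set c := volume.real (cornerSimplex d) with hc
  set β := volume.real (Metric.ball (0 : EuclideanSpace ℝ (Fin d)) 1) with hβ
  have hc0 : c ≠ 0 := (volume_cornerSimplex_pos (d := d)).ne'
  have hdefect : ∀ j : Fin (d + 1), Integrable fun w => (-1 : ℝ) ^ (j : ℕ)
      * sectorDefect fun i => unitHat (y (j.succAbove i) - w) := fun j =>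
    (integrable_sectorDefect hd fun i => y (j.succAbove i)).const_mul _
  have hsum := integrable_finsetSum Finset.univ fun j _ => hdefect j
  have hae : (fun w => rowDet fun i : Fin d =>
      unitHat (y i.castSucc - w) - unitHat (y i.succ - w)) =ᵐ[volume]
      fun w => c⁻¹ * (∑ j : Fin (d + 1), (-1 : ℝ) ^ (j : ℕ)
        * sectorDefect (fun i => unitHat (y (j.succAbove i) - w))
        + commonSign (cofactor fun i => y i - w) * β) := by
    filter_upwards [ae_sum_cofactor_unitHat_mul_volume_sectorCoords hd hdeven hy] with w hw
    rw [← hw, ← Finset.sum_add_distrib, ← sum_cofactor hdeven (fun i => unitHat (y i - w)),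
      Finset.mul_sum]
    refine Finset.sum_congr rfl fun j _ => ?_
    rw [sectorDefect, cofactor, ← hc]
    field_simp
    ring
  refine ⟨((hsum.add (hint.mul_const β)).const_mul c⁻¹).congr hae.symm, ?_⟩
  rw [integral_congr_ae hae, integral_const_mul, integral_add hsum (hint.mul_const β),
    integral_finsetSum _ fun j _ => hdefect j, integral_mul_const, hval]
  simp only [integral_const_mul]
  rw [Finset.sum_eq_zero fun j _ => by
    rw [integral_sectorDefect hd fun i => y (j.succAbove i), mul_zero]]
  field_simp
  ring

lemma volume_real_ball_eq (hd : 0 < d) (hdeven : Even d) :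
    volume.real (Metric.ball (0 : EuclideanSpace ℝ (Fin d)) 1)
      = Real.pi ^ (d / 2) / (d / 2).factorial := by
  have : Nonempty (Fin d) := ⟨⟨0, hd⟩⟩
  rw [Measure.real, InnerProductSpace.volume_ball_of_dim_even (k := d / 2)
    (by rw [finrank_euclideanSpace_fin, Nat.two_mul_div_two_of_even hdeven])]
  simp only [ENNReal.ofReal_one, one_pow, one_mul]
  exact ENNReal.toReal_ofReal (by positivity)

lemma measurable_rowDet_unitHat (y : Fin (d + 1) → EuclideanSpace ℝ (Fin d)) :
    Measurable fun w => rowDet fun i : Fin d =>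
      unitHat (y i.castSucc - w) - unitHat (y i.succ - w) := by
  refine continuous_rowDet.measurable.comp (measurable_pi_lambda _ fun i => ?_)
  exact (measurable_unitHat.comp (measurable_const.sub measurable_id)).sub
    (measurable_unitHat.comp (measurable_const.sub measurable_id))

end Translates

section Campbell

lemma countable_of_subsingleton_inter_ball {E : Type*} [PseudoMetricSpace E]
    [TopologicalSpace.SeparableSpace E] {s : Set E} {r : ℝ} (hr : 0 < r)
    (hs : ∀ x, (s ∩ Metric.ball x r).Subsingleton) : s.Countable := by
  rcases s.eq_empty_or_nonempty with rfl | ⟨x₀, hx₀⟩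
  · exact Set.countable_empty
  have : Nonempty E := ⟨x₀⟩
  have h : s ⊆ ⋃ k, s ∩ Metric.ball (TopologicalSpace.denseSeq E k) r := by
    intro x hx
    obtain ⟨k, hk⟩ := (TopologicalSpace.denseRange_denseSeq E).exists_dist_lt x hr
    exact Set.mem_iUnion.2 ⟨k, hx, hk⟩
  exact (Set.countable_iUnion fun k => (hs _).countable).mono h

variable {E Ω : Type*} [NormedAddCommGroup E] [MeasurableSpace E] [BorelSpace E]
  [SecondCountableTopology E] [MeasurableSpace Ω]

/-- Campbell's formula for a random set whose intensity measure is `μ`. -/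
theorem campbell_formula {P : Measure Ω} {μ : Measure E} {L : Ω → Set E}
    (hL : ∀ ω, (L ω).Countable)
    (hmeas : ∀ V : Set E, MeasurableSet V → Measurable fun ω => ((L ω ∩ V).encard : ℝ≥0∞))
    (hcount : ∀ V : Set E, MeasurableSet V → ∫⁻ ω, ((L ω ∩ V).encard : ℝ≥0∞) ∂P = μ V)
    {f : E → ℝ} (hfm : Measurable f) (hf : Integrable f μ) :
    Integrable (fun ω => ∑' w : L ω, f w) P ∧ ∫ ω, (∑' w : L ω, f w) ∂P = ∫ x, f x ∂μ := by
  set N : Ω → Measure E := fun ω => Measure.count.restrict (L ω) with hN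
  have hNV : ∀ ω V, MeasurableSet V → N ω V = ((L ω ∩ V).encard : ℝ≥0∞) := by
    intro ω V hV
    rw [hN, Measure.restrict_apply hV, Measure.count_apply (hV.inter (hL ω).measurableSet),
      Set.inter_comm]
  have hNm : Measurable N := Measure.measurable_of_measurable_coe _ fun V hV => by
    simpa only [hNV _ V hV] using hmeas V hV
  have hbind : P.bind N = μ := by
    ext V hV
    rw [Measure.bind_apply hV hNm.aemeasurable, ← hcount V hV]
    exact lintegral_congr fun ω => hNV ω V hV
  have hlin : ∀ g : E → ℝ≥0∞, Measurable g → ∫⁻ ω, ∫⁻ x, g x ∂(N ω) ∂P = ∫⁻ x, g x ∂μ := by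
    intro g hg
    rw [← hbind, Measure.lintegral_bind hNm.aemeasurable hg.aemeasurable]
  have hm : ∀ g : E → ℝ≥0∞, Measurable g → Measurable fun ω => ∫⁻ x, g x ∂(N ω) :=
    fun g hg => (Measure.measurable_lintegral hg).comp hNm
  have hpos : Measurable fun x => ENNReal.ofReal (f x) := hfm.ennreal_ofReal
  have hneg : Measurable fun x => ENNReal.ofReal (-f x) := hfm.neg.ennreal_ofReal
  have hposfin : ∫⁻ x, ENNReal.ofReal (f x) ∂μ ≠ ∞ := hf.lintegral_lt_top.ne
  have hnegfin : ∫⁻ x, ENNReal.ofReal (-f x) ∂μ ≠ ∞ := hf.neg.lintegral_lt_top.ne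
  have hae : ∀ᵐ ω ∂P, ∑' w : L ω, f w = (∫⁻ x, ENNReal.ofReal (f x) ∂(N ω)).toReal
      - (∫⁻ x, ENNReal.ofReal (-f x) ∂(N ω)).toReal := by
    have hfin : ∫⁻ ω, ∫⁻ x, ‖f x‖ₑ ∂(N ω) ∂P ≠ ∞ := by
      rw [hlin _ hfm.enorm]
      exact hf.hasFiniteIntegral.ne
    filter_upwards [ae_lt_top (hm _ hfm.enorm) hfin] with ω hω
    have hint : Integrable f (N ω) := ⟨hfm.aestronglyMeasurable, hω⟩
    rw [← integral_eq_lintegral_pos_part_sub_lintegral_neg_part hint,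
      setIntegral_countable f (hL ω) hint]
    refine tsum_congr fun w => ?_
    simp [Measure.real]
  have hip := integrable_toReal_of_lintegral_ne_top (hm _ hpos).aemeasurable
    ((hlin _ hpos).trans_ne hposfin)
  have hin := integrable_toReal_of_lintegral_ne_top (hm _ hneg).aemeasurable
    ((hlin _ hneg).trans_ne hnegfin)
  refine ⟨(hip.sub hin).congr (hae.mono fun ω h => h.symm), ?_⟩
  rw [integral_congr_ae hae, integral_sub hip hin,
    integral_toReal (hm _ hpos).aemeasurable (ae_lt_top (hm _ hpos) ((hlin _ hpos).trans_ne hposfin)),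
    integral_toReal (hm _ hneg).aemeasurable (ae_lt_top (hm _ hneg) ((hlin _ hneg).trans_ne hnegfin)),
    hlin _ hpos, hlin _ hneg, integral_eq_lintegral_pos_part_sub_lintegral_neg_part hf]

theorem campbell_formula_const_mul {P : Measure Ω} {μ : Measure E} {L : Ω → Set E}
    (hL : ∀ ω, (L ω).Countable)
    (hmeas : ∀ V : Set E, MeasurableSet V → Measurable fun ω => ((L ω ∩ V).encard : ℝ≥0∞))
    (hcount : ∀ V : Set E, MeasurableSet V → ∫⁻ ω, ((L ω ∩ V).encard : ℝ≥0∞) ∂P = μ V)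
    {f : E → ℝ} (hfm : Measurable f) (hf : Integrable f μ) {F : E → ℂ} {κ : ℂ}
    (hF : ∀ x, F x = κ * (f x : ℂ)) :
    Integrable (fun ω => ∑' w : L ω, F w) P ∧
      ∫ ω, (∑' w : L ω, F w) ∂P = κ * ((∫ x, f x ∂μ : ℝ) : ℂ) := by
  obtain ⟨hint, hval⟩ := campbell_formula hL hmeas hcount hfm hf
  have hsum : ∀ ω, ∑' w : L ω, F w = κ * ((∑' w : L ω, f w : ℝ) : ℂ) := fun ω => by
    rw [Complex.ofReal_tsum, ← tsum_mul_left]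
    exact tsum_congr fun w => hF w
  simp only [hsum]
  refine ⟨hint.ofReal.const_mul κ, ?_⟩
  rw [integral_const_mul, integral_complex_ofReal, hval]

end Campbell

/-- the geometric identity for random Delone sets (Lemma 5.16 of the paper).
Under the stated hypotheses on the random Delone set `L` (uniform discreteness and relative
density, the averaged counting measure being Lebesgue measure, and invariance under all
point inversions), the function
`ω ↦ Σ_{w ∈ L(ω)} tr(γ₀ ∏_{i=1}^d γ·((y_i − w)^ − (y_{i+1} − w)^))`
is integrable and its integral equals `Λ_d Σ_{λ ∈ S_d} sgn(λ) ∏_{i=1}^d (y_i)_{λ_i}`. -/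
theorem geometric_identity_delone {d : ℕ} (hd : 0 < d) (hdeven : Even d)
    {n : ℕ} (hn : n = 2 ^ (d / 2))
    (γ : Fin d → Matrix (Fin n) (Fin n) ℂ)
    (hγ : ∀ i j, γ i * γ j + γ j * γ i = (if i = j then (2 : ℂ) else 0) • 1)
    (y : Fin (d + 1) → EuclideanSpace ℝ (Fin d)) (hy : y (Fin.last d) = 0)
    {r R : ℝ} (hr : 0 < r) (hrR : r < R)
    {Ω : Type*} [MeasurableSpace Ω] (P : Measure Ω) [IsProbabilityMeasure P]
    (L : Ω → Set (EuclideanSpace ℝ (Fin d)))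
    (hUD : ∀ ω x, (L ω ∩ Metric.ball x r).Subsingleton)
    (hRD : ∀ ω x, (L ω ∩ Metric.ball x R).Nonempty)
    (hmeas : ∀ V : Set (EuclideanSpace ℝ (Fin d)), MeasurableSet V →
      Measurable fun ω => ((L ω ∩ V).encard : ℝ≥0∞))
    (hcount : ∀ V : Set (EuclideanSpace ℝ (Fin d)), MeasurableSet V →
      ∫⁻ ω, ((L ω ∩ V).encard : ℝ≥0∞) ∂P = volume V)
    (hinv : ∀ c : EuclideanSpace ℝ (Fin d), ∃ ι : Ω → Ω,
      MeasurePreserving ι P P ∧ ∀ ω, L (ι ω) = (fun w => (2 : ℝ) • c - w) '' L ω) :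
    Integrable (fun ω => ∑' w : L ω, cliffordIntegrand γ y (w : EuclideanSpace ℝ (Fin d))) P ∧
    ∫ ω, (∑' w : L ω, cliffordIntegrand γ y (w : EuclideanSpace ℝ (Fin d))) ∂P =
      LambdaD d * ∑ σ : Equiv.Perm (Fin d),
        ((Equiv.Perm.sign σ : ℤ) : ℂ) * ∏ i : Fin d, ((y i.castSucc (σ i) : ℝ) : ℂ) := by
  have hcountable : ∀ ω, (L ω).Countable := fun ω =>
    countable_of_subsingleton_inter_ball hr (hUD ω)
  obtain ⟨hint, hval⟩ := integrable_rowDet_unitHat_and_integral_eq hd hdeven hy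
  obtain ⟨hintP, hvalP⟩ := campbell_formula_const_mul hcountable hmeas hcount
    (measurable_rowDet_unitHat y) hint
    (F := cliffordIntegrand γ y) fun w => trace_gammaZero_mul_gammaDot hdeven hn hγ _
  refine ⟨hintP, ?_⟩
  rw [hvalP, hval, volume_real_ball_eq hd hdeven, ← ofReal_rowDet, LambdaD,
    mul_pow (2 * Complex.I)]
  push_cast
  ring
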